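/- arXiv:1403.1785 — 4 statements merged into one kernel-verified Lean document; each statement's English description precedes it below -/
import Mathlib

section
/- Let d ≥ 3 and m ≥ 0 be integers and let l > 0, λ > 0 be real. For every Schwartz function φ on ℝ^d one has the identity −(λ^{−d}/(m+1)) ∫_{ℝ^d} |x|^{−d} (log(λ|x|/l))^{m+1} (x·∇φ(x)) dx = Σ_{k=0}^{m} λ^{−d} (log λ)^k C(m,k) ⟨R_d[r^{−d} log^{m−k}(r/l)], φ⟩ + λ^{−d} (log λ)^{m+1} (Ω_d/(m+1)) φ(0), where C(m,k) is the binomial coefficient; all integrals occurring are absolutely convergent. (In particular R_d[r^{−d} log^m(r/l)] is log-homogeneous of bidegree (−d, m+1).) -/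
open MeasureTheory Real SchwartzMap

noncomputable section

/-- The surface area of the unit sphere in `ℝ^d`. -/
def Omega (d : ℕ) : ℝ := 2 * Real.pi ^ ((d : ℝ) / 2) / Real.Gamma ((d : ℝ) / 2)

lemma aux_log_bound (n : ℕ) (c : ℝ) (hc : 0 < c) : ∃ K : ℝ, 0 ≤ K ∧ ∀ r : ℝ, 0 < r →
    |Real.log (c * r)| ^ n ≤ K * (r ^ (1/2 : ℝ) + r ^ (-(1/2) : ℝ)) := by
  refine ⟨2 ^ n * n.factorial * (c ^ (1/2 : ℝ) + c ^ (-(1/2) : ℝ)), by positivity, ?_⟩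
  intro r hr
  have hy : 0 < c * r := mul_pos hc hr
  have h1 := Real.pow_div_factorial_le_exp (x := |Real.log (c * r)| / 2) (by positivity) n
  have h2 : Real.exp (|Real.log (c * r)| / 2) ≤
      (c * r) ^ (1/2 : ℝ) + (c * r) ^ (-(1/2) : ℝ) := by
    rw [Real.rpow_def_of_pos hy, Real.rpow_def_of_pos hy]
    rcases abs_cases (Real.log (c * r)) with ⟨h, _⟩ | ⟨h, _⟩
    · rw [h]
      have : Real.log (c * r) / 2 = Real.log (c * r) * (1/2) := by ring
      rw [this]
      linarith [Real.exp_pos (Real.log (c * r) * (-(1/2)))]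
    · rw [h]
      have : -Real.log (c * r) / 2 = Real.log (c * r) * (-(1/2)) := by ring
      rw [this]
      linarith [Real.exp_pos (Real.log (c * r) * ((1/2)))]
  have h3 : (c * r) ^ (1/2 : ℝ) + (c * r) ^ (-(1/2) : ℝ) ≤
      (c ^ (1/2 : ℝ) + c ^ (-(1/2) : ℝ)) * (r ^ (1/2 : ℝ) + r ^ (-(1/2) : ℝ)) := by
    rw [Real.mul_rpow hc.le hr.le, Real.mul_rpow hc.le hr.le]
    have e1 : 0 ≤ c ^ (1/2 : ℝ) * r ^ (-(1/2) : ℝ) := by positivity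
    have e2 : 0 ≤ c ^ (-(1/2) : ℝ) * r ^ (1/2 : ℝ) := by positivity
    nlinarith
  have h4 : |Real.log (c * r)| ^ n =
      2 ^ n * n.factorial * ((|Real.log (c * r)| / 2) ^ n / n.factorial) := by
    have : (n.factorial : ℝ) ≠ 0 := by positivity
    rw [div_pow]; field_simp
  rw [h4, mul_assoc (2 ^ n * (n.factorial : ℝ))]
  exact mul_le_mul_of_nonneg_left (h1.trans (h2.trans h3)) (by positivity)

lemma aux_radial : IntegrableOn (fun r : ℝ => (r ^ (1/2 : ℝ) + r ^ (-(1/2) : ℝ)) / (1 + r) ^ 2)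
    (Set.Ioi 0) := by
  have hm : Measurable (fun r : ℝ => (r ^ (1/2 : ℝ) + r ^ (-(1/2) : ℝ)) / (1 + r) ^ 2) := by
    fun_prop
  rw [← Set.Ioc_union_Ioi_eq_Ioi (zero_le_one (α := ℝ))]
  refine IntegrableOn.union ?_ ?_
  · have h : IntegrableOn (fun r : ℝ => 2 * r ^ (-(1/2) : ℝ)) (Set.Ioc 0 1) := by
      have := (intervalIntegral.intervalIntegrable_rpow' (a := 0) (b := 1) (r := -(1/2))
        (by norm_num)).1
      exact this.const_mul 2
    refine h.mono' hm.aestronglyMeasurable ?_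
    filter_upwards [ae_restrict_mem measurableSet_Ioc] with r hr
    obtain ⟨h0, h1⟩ := hr
    have a : r ^ (1/2 : ℝ) ≤ r ^ (-(1/2) : ℝ) :=
      Real.rpow_le_rpow_of_exponent_ge h0 h1 (by norm_num)
    have a0 : 0 < r ^ (-(1/2) : ℝ) := by positivity
    rw [Real.norm_of_nonneg (by positivity), div_le_iff₀ (by positivity)]
    nlinarith [mul_pos a0 h0, mul_pos (mul_pos a0 h0) h0]
  · have h : IntegrableOn (fun r : ℝ => 2 * r ^ (-(3/2) : ℝ)) (Set.Ioi 1) :=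
      (integrableOn_Ioi_rpow_of_lt (by norm_num) one_pos).const_mul 2
    refine h.mono' hm.aestronglyMeasurable ?_
    filter_upwards [ae_restrict_mem measurableSet_Ioi] with r hr
    have h1 : (1:ℝ) < r := hr
    have h0 : 0 < r := by linarith
    have a : r ^ (-(1/2) : ℝ) ≤ r ^ (1/2 : ℝ) :=
      Real.rpow_le_rpow_of_exponent_le h1.le (by norm_num)
    have b : r ^ (1/2 : ℝ) = r ^ (-(3/2) : ℝ) * r ^ 2 := by
      rw [← Real.rpow_natCast r 2, ← Real.rpow_add h0]; norm_num
    have a0 : 0 < r ^ (-(3/2) : ℝ) := by positivity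
    rw [Real.norm_of_nonneg (by positivity), div_le_iff₀ (by positivity)]
    nlinarith [mul_pos a0 h0]

lemma aux_decay {d : ℕ} (φ : SchwartzMap (EuclideanSpace ℝ (Fin d)) ℝ) :
    ∃ C : ℝ, 0 ≤ C ∧ ∀ x, ‖fderiv ℝ (⇑φ) x‖ ≤ C / (1 + ‖x‖) ^ 2 := by
  have h := fun x => SchwartzMap.one_add_le_sup_seminorm_apply (𝕜 := ℝ) (m := (2, 1)) (k := 2)
    (n := 1) le_rfl le_rfl φ x
  refine ⟨_, le_trans (by positivity) (h 0), fun x => ?_⟩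
  rw [le_div_iff₀ (by positivity), mul_comm, ← norm_iteratedFDeriv_one]
  exact h x

lemma aux_integrable {d : ℕ} (hd : 3 ≤ d) (n : ℕ) (c : ℝ) (hc : 0 < c)
    (φ : SchwartzMap (EuclideanSpace ℝ (Fin d)) ℝ) :
    Integrable (fun x : EuclideanSpace ℝ (Fin d) =>
        ‖x‖ ^ (-(d : ℝ)) * (Real.log (c * ‖x‖)) ^ n * fderiv ℝ (⇑φ) x x) := by
  obtain ⟨C, hC, hφ⟩ := aux_decay φ
  obtain ⟨K, hK, hlog⟩ := aux_log_bound n c hc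
  haveI : Nonempty (Fin d) := ⟨⟨0, by omega⟩⟩
  have hg : Integrable (fun x : EuclideanSpace ℝ (Fin d) =>
      (fun r : ℝ => r ^ (-(d : ℝ)) * (K * (r ^ (1/2 : ℝ) + r ^ (-(1/2) : ℝ))) *
        (C / (1 + r) ^ 2 * r)) ‖x‖) := by
    rw [integrable_fun_norm_addHaar volume (f := (fun r : ℝ => r ^ (-(d : ℝ)) *
      (K * (r ^ (1/2 : ℝ) + r ^ (-(1/2) : ℝ))) * (C / (1 + r) ^ 2 * r)))]
    refine IntegrableOn.congr_fun (aux_radial.const_mul (K * C)) ?_ measurableSet_Ioi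
    intro r hr
    have h0 : 0 < r := hr
    have e : r ^ (d - 1) * r ^ (-(d : ℝ)) * r = 1 := by
      rw [mul_right_comm, ← pow_succ, Nat.sub_add_cancel (by omega), Real.rpow_neg h0.le,
        Real.rpow_natCast]
      exact mul_inv_cancel₀ (by positivity)
    simp only [finrank_euclideanSpace, Fintype.card_fin, smul_eq_mul]
    calc _ = K * C * ((r ^ (1/2 : ℝ) + r ^ (-(1/2) : ℝ)) / (1 + r) ^ 2) * 1 := by ring
      _ = _ := by rw [← e]; ring
  have hcont : Continuous (fun x : EuclideanSpace ℝ (Fin d) => fderiv ℝ (⇑φ) x x) :=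
    ((φ.smooth 1).continuous_fderiv (by norm_num)).clm_apply continuous_id
  refine hg.mono' ?_ ?_
  · have := hcont.measurable
    refine Measurable.aestronglyMeasurable ?_
    fun_prop
  · filter_upwards with x
    rcases eq_or_ne x 0 with rfl | hx
    · simp
    have h0 : 0 < ‖x‖ := norm_pos_iff.mpr hx
    rw [norm_mul, norm_mul, norm_pow, Real.norm_eq_abs (Real.log _),
      Real.norm_of_nonneg (by positivity : 0 ≤ ‖x‖ ^ (-(d : ℝ)))]
    have := (fderiv ℝ (⇑φ) x).le_opNorm x
    gcongr
    · exact hlog _ h0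
    · exact this.trans (by gcongr; exact hφ x)

lemma aux_ftc {d : ℕ} (φ : SchwartzMap (EuclideanSpace ℝ (Fin d)) ℝ)
    (w : EuclideanSpace ℝ (Fin d)) (hw : ‖w‖ = 1) :
    ∫ r in Set.Ioi (0:ℝ), fderiv ℝ (⇑φ) (r • w) w = - φ 0 := by
  obtain ⟨C, hC, hφ⟩ := aux_decay φ
  have hd : ∀ r : ℝ, HasDerivAt (fun r : ℝ => φ (r • w)) (fderiv ℝ (⇑φ) (r • w) w) r := by
    intro r
    have h1 : HasDerivAt (fun r : ℝ => r • w) w r := by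
      simpa using (hasDerivAt_id r).smul_const w
    exact (φ.differentiableAt.hasFDerivAt).comp_hasDerivAt r h1
  have hcont : Continuous (fun r : ℝ => fderiv ℝ (⇑φ) (r • w) w) :=
    (((φ.smooth 1).continuous_fderiv (by norm_num)).comp (by fun_prop)).clm_apply continuous_const
  have hint : IntegrableOn (fun r : ℝ => fderiv ℝ (⇑φ) (r • w) w) (Set.Ioi 0) := by
    refine ((integrable_inv_one_add_sq.const_mul C).integrableOn).mono'
      hcont.aestronglyMeasurable ?_
    filter_upwards [ae_restrict_mem measurableSet_Ioi] with r hr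
    have h0 : 0 < r := hr
    have h1 := (fderiv ℝ (⇑φ) (r • w)).le_opNorm w
    have h2 := hφ (r • w)
    rw [hw, mul_one] at h1
    rw [norm_smul, hw, mul_one, Real.norm_of_nonneg h0.le] at h2
    refine h1.trans (h2.trans ?_)
    rw [div_eq_mul_inv]
    gcongr
    nlinarith
  have ht : Filter.Tendsto (fun r : ℝ => φ (r • w)) Filter.atTop (nhds 0) := by
    refine φ.tendsto_cocompact.comp ?_
    refine tendsto_cocompact_of_tendsto_dist_comp_atTop 0 ?_
    simp only [dist_zero_right, norm_smul, hw, mul_one]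
    exact tendsto_norm_atTop_atTop
  have := integral_Ioi_of_hasDerivAt_of_tendsto' (fun r _ => hd r) hint ht
  simpa using this

lemma aux_sphere {d : ℕ} (hd : 3 ≤ d) :
    (volume : Measure (EuclideanSpace ℝ (Fin d))).toSphere.real Set.univ = Omega d := by
  haveI : Nonempty (Fin d) := ⟨⟨0, by omega⟩⟩
  have hd0 : (0:ℝ) < d := by exact_mod_cast (by omega : 0 < d)
  rw [Measure.toSphere_real_apply_univ, measureReal_def, EuclideanSpace.volume_ball, Omega]
  have hG : 0 < Real.Gamma ((d:ℝ) / 2) := Real.Gamma_pos_of_pos (by positivity)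
  have hp : √π ^ d = π ^ ((d:ℝ)/2) := by
    rw [Real.sqrt_eq_rpow, ← Real.rpow_natCast, ← Real.rpow_mul Real.pi_pos.le]
    congr 1; ring
  simp only [finrank_euclideanSpace, Fintype.card_fin, ENNReal.ofReal_one, one_pow, one_mul]
  rw [ENNReal.toReal_ofReal (by positivity), hp, Real.Gamma_add_one (by positivity)]
  field_simp

lemma aux_main {d : ℕ} (hd : 3 ≤ d) (φ : SchwartzMap (EuclideanSpace ℝ (Fin d)) ℝ) :
    ∫ x : EuclideanSpace ℝ (Fin d), ‖x‖ ^ (-(d : ℝ)) * fderiv ℝ (⇑φ) x x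
      = - (Omega d * φ 0) := by
  haveI : Nonempty (Fin d) := ⟨⟨0, by omega⟩⟩
  set F : EuclideanSpace ℝ (Fin d) → ℝ := fun x => ‖x‖ ^ (-(d : ℝ)) * fderiv ℝ (⇑φ) x x with hF
  have hFi : Integrable F := by
    simpa [hF] using aux_integrable hd 0 1 one_pos φ
  have mp := (volume : Measure (EuclideanSpace ℝ (Fin d))).measurePreserving_homeomorphUnitSphereProd
  have emb := (homeomorphUnitSphereProd (EuclideanSpace ℝ (Fin d))).measurableEmbedding
  set H : Metric.sphere (0 : EuclideanSpace ℝ (Fin d)) 1 × Set.Ioi (0:ℝ) → ℝ :=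
    fun p => F (p.2.1 • p.1.1) with hH
  have hHe : ∀ x : ({0}ᶜ : Set (EuclideanSpace ℝ (Fin d))),
      H (homeomorphUnitSphereProd _ x) = F x.1 := by
    intro x
    have : ‖x.1‖ ≠ 0 := norm_ne_zero_iff.mpr x.2
    simp [hH, smul_smul, this]
  have hHi := (mp.integrable_comp_emb (g := H) emb).1 (by
    have h1 : IntegrableOn F ({0}ᶜ) := hFi.integrableOn
    rw [integrableOn_iff_comap_subtypeVal (measurableSet_singleton _).compl] at h1
    refine h1.congr (Filter.Eventually.of_forall fun x => (hHe x).symm))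
  have hinner : ∀ w : Metric.sphere (0 : EuclideanSpace ℝ (Fin d)) 1,
      ∫ r, H (w, r) ∂(Measure.volumeIoiPow (d - 1)) = - φ 0 := by
    intro w
    have hw : ‖w.1‖ = 1 := by simp
    simp only [Measure.volumeIoiPow, ENNReal.ofReal]
    rw [integral_withDensity_eq_integral_smul
      ((measurable_subtype_coe.pow_const _).real_toNNReal),
      integral_subtype_comap measurableSet_Ioi
        fun a : ℝ ↦ Real.toNNReal (a ^ (d - 1)) • F (a • w.1),
      ← aux_ftc φ w.1 hw]
    refine setIntegral_congr_fun measurableSet_Ioi fun r hr ↦ ?_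
    have h0 : 0 < r := hr
    have e : r ^ (d - 1) * r ^ (-(d : ℝ)) * r = 1 := by
      rw [mul_right_comm, ← pow_succ, Nat.sub_add_cancel (by omega), Real.rpow_neg h0.le,
        Real.rpow_natCast]
      exact mul_inv_cancel₀ (by positivity)
    simp only [hF, NNReal.smul_def, Real.coe_toNNReal _ (pow_nonneg h0.le _), smul_eq_mul,
      norm_smul, hw, mul_one, Real.norm_of_nonneg h0.le, map_smul]
    calc _ = (r ^ (d - 1) * r ^ (-(d : ℝ)) * r) * fderiv ℝ (⇑φ) (r • w.1) w.1 := by ring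
      _ = _ := by rw [e, one_mul]
  calc ∫ x, F x = ∫ x : ({0}ᶜ : Set (EuclideanSpace ℝ (Fin d))), F x.1 ∂(volume.comap Subtype.val) := by
        rw [integral_subtype_comap (measurableSet_singleton _).compl F, restrict_compl_singleton]
    _ = ∫ p, H p ∂(volume.toSphere.prod (.volumeIoiPow
          (Module.finrank ℝ (EuclideanSpace ℝ (Fin d)) - 1))) := by
        rw [← mp.integral_comp emb H]
        exact integral_congr_ae (Filter.Eventually.of_forall fun x => (hHe x).symm)
    _ = - (Omega d * φ 0) := by
        rw [integral_prod _ hHi]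
        simp only [finrank_euclideanSpace, Fintype.card_fin, hinner, integral_const,
          aux_sphere hd, smul_eq_mul, mul_neg]

/-- dilation behaviour of the renormalized distribution
`R_d[r^{-d} log^m (r/l)]`, i.e. Lemma `logdiv-dilation` of the paper.  All integrals
occurring are absolutely convergent, and
`-(λ^{-d}/(m+1)) ∫ |x|^{-d} (log(λ|x|/l))^{m+1} (x·∇φ(x)) dx
  = Σ_{k=0}^{m} λ^{-d} (log λ)^k C(m,k) ⟨R_d[r^{-d} log^{m-k}(r/l)], φ⟩
    + λ^{-d} (log λ)^{m+1} (Ω_d/(m+1)) φ(0)`. -/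
theorem stmt_0 (d m : ℕ) (hd : 3 ≤ d) (l lam : ℝ) (hl : 0 < l) (hlam : 0 < lam)
    (φ : SchwartzMap (EuclideanSpace ℝ (Fin d)) ℝ) :
    Integrable (fun x : EuclideanSpace ℝ (Fin d) =>
        ‖x‖ ^ (-(d : ℝ)) * (Real.log (lam * ‖x‖ / l)) ^ (m + 1) * fderiv ℝ (⇑φ) x x) ∧
    (∀ k ≤ m, Integrable (fun x : EuclideanSpace ℝ (Fin d) =>
        ‖x‖ ^ (-(d : ℝ)) * (Real.log (‖x‖ / l)) ^ (k + 1) * fderiv ℝ (⇑φ) x x)) ∧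
    -(lam ^ (-(d : ℝ)) / (m + 1)) *
        (∫ x : EuclideanSpace ℝ (Fin d),
          ‖x‖ ^ (-(d : ℝ)) * (Real.log (lam * ‖x‖ / l)) ^ (m + 1) * fderiv ℝ (⇑φ) x x)
      = (∑ k ∈ Finset.range (m + 1),
          lam ^ (-(d : ℝ)) * (Real.log lam) ^ k * (m.choose k : ℝ) *
            (-(1 / ((m - k : ℕ) + 1 : ℝ)) *
              ∫ x : EuclideanSpace ℝ (Fin d),
                ‖x‖ ^ (-(d : ℝ)) * (Real.log (‖x‖ / l)) ^ ((m - k) + 1) *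
                  fderiv ℝ (⇑φ) x x))
        + lam ^ (-(d : ℝ)) * (Real.log lam) ^ (m + 1) * (Omega d / (m + 1)) * φ 0 := by
  have hI : ∀ n : ℕ, Integrable (fun x : EuclideanSpace ℝ (Fin d) =>
        ‖x‖ ^ (-(d : ℝ)) * (Real.log (‖x‖ / l)) ^ n * fderiv ℝ (⇑φ) x x) := by
    intro n
    simpa only [div_eq_inv_mul] using aux_integrable hd n l⁻¹ (inv_pos.mpr hl) φ
  refine ⟨?_, fun k _ => hI (k + 1), ?_⟩
  · simpa only [mul_div_right_comm] using aux_integrable hd (m + 1) (lam / l) (div_pos hlam hl) φ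
  have key : (∫ x : EuclideanSpace ℝ (Fin d),
        ‖x‖ ^ (-(d : ℝ)) * (Real.log (lam * ‖x‖ / l)) ^ (m + 1) * fderiv ℝ (⇑φ) x x) =
      ∑ k ∈ Finset.range (m + 2), (Real.log lam) ^ k * ((m + 1).choose k : ℝ) *
        ∫ x : EuclideanSpace ℝ (Fin d),
          ‖x‖ ^ (-(d : ℝ)) * (Real.log (‖x‖ / l)) ^ (m + 1 - k) * fderiv ℝ (⇑φ) x x := by
    simp_rw [← integral_const_mul]
    rw [← integral_finsetSum _ (fun k _ => (hI _).const_mul _)]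
    refine integral_congr_ae (Filter.Eventually.of_forall fun x => ?_)
    dsimp only
    rcases eq_or_ne x 0 with rfl | hx
    · simp
    have h0 : 0 < ‖x‖ := norm_pos_iff.mpr hx
    rw [mul_div_assoc, Real.log_mul hlam.ne' (by positivity), add_pow, Finset.mul_sum,
      Finset.sum_mul]
    exact Finset.sum_congr rfl fun k _ => by ring
  rw [key, Finset.sum_range_succ, mul_add, Finset.mul_sum]
  congr 1
  · refine Finset.sum_congr rfl fun k hk => ?_
    have hk' : k ≤ m := by simpa [Nat.lt_succ_iff] using hk
    have e1 : m + 1 - k = m - k + 1 := by omega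
    have e2 : ((m + 1).choose k : ℝ) * ((m - k : ℕ) + 1 : ℝ) = (m.choose k : ℝ) * (m + 1) := by
      have := Nat.choose_mul_succ_eq m k
      rw [e1] at this
      exact_mod_cast this.symm
    have e3 : ((m + 1).choose k : ℝ) = (m.choose k : ℝ) * (m + 1) / ((m - k : ℕ) + 1 : ℝ) := by
      rw [eq_div_iff (by positivity), e2]
    have e4 : (m + 1 : ℝ) ≠ 0 := by positivity
    rw [e1, e3]
    generalize (∫ x : EuclideanSpace ℝ (Fin d),
          ‖x‖ ^ (-(d : ℝ)) * (Real.log (‖x‖ / l)) ^ (m - k + 1) * fderiv ℝ (⇑φ) x x) = I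
    field_simp
  · simp only [Nat.sub_self, pow_zero, mul_one, Nat.choose_self, Nat.cast_one, aux_main hd φ]
    ring

end
end

section
/- Let d ≥ 3 and m ≥ 1 be integers and let l > 0. For every Schwartz function φ on ℝ^d one has ⟨R_d[r^{−d} log^m(r/l)], d·φ + x·∇φ⟩ = d ⟨R_d[r^{−d} log^m(r/l)], φ⟩ − m ⟨R_d[r^{−d} log^{m−1}(r/l)], φ⟩. Equivalently, with the Euler operator E defined on distributions by ⟨ET, φ⟩ := −⟨T, d·φ + x·∇φ⟩, one has E R_d[r^{−d} log^m(r/l)] = −d·R_d[r^{−d} log^m(r/l)] + m·R_d[r^{−d} log^{m−1}(r/l)]; in particular the extension commutes with E on r^{−d} log^m(r/l) for m ≥ 1 (the higher residues vanish). -/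
open MeasureTheory Real SchwartzMap
noncomputable section
open Filter Topology Asymptotics

def gmin (t : ℝ) : ℝ := min t t⁻¹

lemma logpow_top (l : ℝ) (hl : 0 < l) (k : ℕ) :
    (fun t : ℝ => |Real.log (t / l)| ^ k) =O[atTop] (fun t => t ^ (1/2 : ℝ)) := by
  have h1 := (isLittleO_log_rpow_rpow_atTop (s := 1/2) (k:ℝ) (by norm_num)).isBigO
  have ht : Tendsto (fun t : ℝ => t / l) atTop atTop := tendsto_id.atTop_div_const hl
  have h2 := (h1.comp_tendsto ht).norm_left
  have h3 : ((fun x : ℝ => x ^ (1/2 : ℝ)) ∘ fun t => t / l) =O[atTop] fun t => t ^ (1/2:ℝ) := by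
    refine IsBigO.of_bound (‖(l ^ (1/2:ℝ))⁻¹‖) ?_
    filter_upwards [eventually_gt_atTop 0] with t ht
    rw [← norm_mul]
    simp only [Function.comp]
    rw [Real.div_rpow ht.le hl.le, div_eq_mul_inv, mul_comm]
  refine (h2.trans h3).congr_left ?_
  intro t
  simp [Function.comp, Real.rpow_natCast]

lemma logpow_zero (l : ℝ) (hl : 0 < l) (k : ℕ) :
    (fun t : ℝ => |Real.log (t / l)| ^ k) =O[𝓝[>] 0] (fun t => t ^ (-(1/2) : ℝ)) := by
  have h1 := (isLittleO_abs_log_rpow_rpow_nhdsGT_zero (s := -(1/2)) (k:ℝ) (by norm_num)).isBigO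
  have ht : Tendsto (fun t : ℝ => t / l) (𝓝[>] 0) (𝓝[>] 0) := by
    apply tendsto_nhdsWithin_of_tendsto_nhds_of_eventually_within
    · have : ContinuousAt (fun t : ℝ => t / l) 0 := by fun_prop
      simpa [ContinuousAt] using this.tendsto.mono_left nhdsWithin_le_nhds
    · filter_upwards [self_mem_nhdsWithin] with t ht
      exact div_pos ht hl
  have h2 := (h1.comp_tendsto ht)
  have h3 : ((fun x : ℝ => x ^ (-(1/2) : ℝ)) ∘ fun t => t / l) =O[𝓝[>] 0] fun t => t ^ (-(1/2):ℝ) := by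
    refine IsBigO.of_bound (‖(l ^ (-(1/2):ℝ))⁻¹‖) ?_
    filter_upwards [self_mem_nhdsWithin] with t ht
    rw [← norm_mul]
    simp only [Function.comp]
    rw [Real.div_rpow (le_of_lt ht) hl.le, div_eq_mul_inv, mul_comm]
  refine (h2.trans h3).congr_left ?_
  intro t
  simp [Function.comp, Real.rpow_natCast]

lemma lg_top (l : ℝ) (hl : 0 < l) (k : ℕ) :
    (fun t : ℝ => |Real.log (t / l)| ^ k * gmin t) =O[atTop] (fun t => t ^ (-(1/2) : ℝ)) := by
  have h : gmin =O[atTop] (fun t : ℝ => t⁻¹) := by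
    refine IsBigO.of_bound 1 ?_
    filter_upwards [eventually_gt_atTop 0] with t ht
    have : 0 < t⁻¹ := inv_pos.2 ht
    unfold gmin
    rw [Real.norm_of_nonneg (le_min ht.le this.le), Real.norm_of_nonneg this.le, one_mul]
    exact min_le_right _ _
  refine ((logpow_top l hl k).mul h).congr' .rfl ?_
  filter_upwards [eventually_gt_atTop 0] with t ht
  rw [← Real.rpow_neg_one, ← Real.rpow_add ht]; norm_num

lemma lg_zero (l : ℝ) (hl : 0 < l) (k : ℕ) :
    (fun t : ℝ => |Real.log (t / l)| ^ k * gmin t) =O[𝓝[>] 0] (fun t => t ^ (-(-(1/2)) : ℝ)) := by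
  have h : gmin =O[𝓝[>] 0] (fun t : ℝ => t) := by
    refine IsBigO.of_bound 1 ?_
    filter_upwards [self_mem_nhdsWithin] with t ht
    have ht : 0 < t := ht
    have : 0 < t⁻¹ := inv_pos.2 ht
    unfold gmin
    rw [Real.norm_of_nonneg (le_min ht.le this.le), Real.norm_of_nonneg ht.le, one_mul]
    exact min_le_left _ _
  refine ((logpow_zero l hl k).mul h).congr' .rfl ?_
  filter_upwards [self_mem_nhdsWithin] with t ht
  nth_rewrite 2 [← Real.rpow_one t]
  rw [← Real.rpow_add ht]; norm_num

lemma lg_int (l : ℝ) (hl : 0 < l) (k : ℕ) :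
    IntegrableOn (fun t : ℝ => t ^ (-1 : ℝ) * (|Real.log (t / l)| ^ k * gmin t)) (Set.Ioi 0) := by
  have := mellin_convergent_of_isBigO_scalar (s := 0) (a := 1/2) (b := -(1/2))
    (f := fun t : ℝ => |Real.log (t / l)| ^ k * gmin t) ?_ (lg_top l hl k) (by norm_num)
    (lg_zero l hl k) (by norm_num)
  · simpa using this
  · apply ContinuousOn.locallyIntegrableOn _ measurableSet_Ioi
    intro t ht
    have h0 : t ≠ 0 := ne_of_gt ht
    have h1 : t / l ≠ 0 := div_ne_zero h0 hl.ne'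
    unfold gmin
    apply ContinuousAt.continuousWithinAt
    fun_prop (disch := assumption)

lemma int_main (d k : ℕ) (hd : 3 ≤ d) (l : ℝ) (hl : 0 < l)
    (f : EuclideanSpace ℝ (Fin d) → ℝ) (hf : Continuous f) (C : ℝ)
    (hC : ∀ x, |f x| ≤ C * gmin ‖x‖) :
    Integrable (fun x : EuclideanSpace ℝ (Fin d) =>
      ‖x‖ ^ (-(d : ℝ)) * (Real.log (‖x‖ / l)) ^ k * f x) := by
  have : Nonempty (Fin d) := ⟨⟨0, by omega⟩⟩
  have h1 : Integrable (fun x : EuclideanSpace ℝ (Fin d) =>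
      (fun t : ℝ => t ^ (-(d:ℝ)) * |Real.log (t / l)| ^ k * (C * gmin t)) ‖x‖) := by
    refine (integrable_fun_norm_addHaar (volume : Measure (EuclideanSpace ℝ (Fin d)))
      (f := fun t : ℝ => t ^ (-(d:ℝ)) * |Real.log (t / l)| ^ k * (C * gmin t))).2 ?_
    refine IntegrableOn.congr_fun ((lg_int l hl k).const_mul C) ?_ measurableSet_Ioi
    intro t ht
    have ht : 0 < t := ht
    simp only [finrank_euclideanSpace, Fintype.card_fin, smul_eq_mul]
    have : t ^ (-1:ℝ) = t ^ (d-1) * t ^ (-(d:ℝ)) := by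
      rw [← Real.rpow_natCast, ← Real.rpow_add ht, Nat.cast_sub (by omega)]; congr 1; push_cast; ring
    rw [this]; ring
  refine h1.mono' ?_ ?_
  · apply Measurable.aestronglyMeasurable
    have := hf.measurable
    fun_prop
  · refine .of_forall fun x => ?_
    simp only [norm_mul, norm_pow, Real.norm_eq_abs]
    rw [abs_of_nonneg (Real.rpow_nonneg (norm_nonneg x) _)]
    gcongr
    exact hC x

lemma euler_bd (d : ℕ) (χ : SchwartzMap (EuclideanSpace ℝ (Fin d)) ℝ) :
    ∃ C : ℝ, ∀ x, |fderiv ℝ (⇑χ) x x| ≤ C * gmin ‖x‖ := by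
  obtain ⟨C0, h0, hC0⟩ := χ.decay 0 1
  obtain ⟨C2, h2, hC2⟩ := χ.decay 2 1
  refine ⟨max C0 C2, fun x => ?_⟩
  have hb : |fderiv ℝ (⇑χ) x x| ≤ ‖fderiv ℝ (⇑χ) x‖ * ‖x‖ := (fderiv ℝ (⇑χ) x).le_opNorm x
  have a0 := hC0 x
  have a2 := hC2 x
  rw [norm_iteratedFDeriv_one] at a0 a2
  unfold gmin
  rcases eq_or_ne x 0 with rfl | hx
  · simp
  have hn : 0 < ‖x‖ := norm_pos_iff.2 hx
  have hm : 0 < max C0 C2 := lt_max_of_lt_left h0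
  rw [mul_min_of_nonneg _ _ hm.le, le_min_iff]
  constructor
  · refine hb.trans ?_
    gcongr
    simp at a0
    exact le_max_of_le_left a0
  · rw [← div_eq_mul_inv, le_div_iff₀ hn]
    calc _ ≤ ‖fderiv ℝ (⇑χ) x‖ * ‖x‖ * ‖x‖ := by gcongr
      _ = ‖x‖^2 * ‖fderiv ℝ (⇑χ) x‖ := by ring
      _ ≤ _ := le_max_of_le_right a2

def eul (d : ℕ) (φ : SchwartzMap (EuclideanSpace ℝ (Fin d)) ℝ) :
    SchwartzMap (EuclideanSpace ℝ (Fin d)) ℝ :=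
  SchwartzMap.bilinLeftCLM (𝕜 := ℝ) (ContinuousLinearMap.id ℝ (EuclideanSpace ℝ (Fin d) →L[ℝ] ℝ))
    (g := fun x => x) (ContinuousLinearMap.id ℝ (EuclideanSpace ℝ (Fin d))).hasTemperateGrowth
    (SchwartzMap.fderivCLM ℝ _ _ φ)

lemma eul_apply (d : ℕ) (φ : SchwartzMap (EuclideanSpace ℝ (Fin d)) ℝ) (x) :
   eul d φ x = fderiv ℝ (⇑φ) x x := rfl

lemma polar_zero (d : ℕ) (hd : 3 ≤ d) (F : EuclideanSpace ℝ (Fin d) → ℝ) (hF : Integrable F)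
    (h : ∀ w : EuclideanSpace ℝ (Fin d), ‖w‖ = 1 →
      IntegrableOn (fun r : ℝ => r ^ (d-1) * F (r • w)) (Set.Ioi 0) →
      ∫ r in Set.Ioi (0:ℝ), r ^ (d-1) * F (r • w) = 0) :
    ∫ x, F x = 0 := by
  have : Nonempty (Fin d) := ⟨⟨0, by omega⟩⟩
  let E := EuclideanSpace ℝ (Fin d)
  let G : Metric.sphere (0:E) 1 × Set.Ioi (0:ℝ) → ℝ := fun p => F (p.2.1 • p.1.1)
  have hG : ∀ x : ({0}ᶜ : Set E), G (homeomorphUnitSphereProd E x) = F x := by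
    intro x
    have hx : ‖(x:E)‖ ≠ 0 := norm_ne_zero_iff.2 x.2
    simp [G, smul_smul, hx]
  have e1 : ∫ x, F x = ∫ x : ({0}ᶜ : Set E), F x ∂((volume : Measure E).comap Subtype.val) := by
    rw [integral_subtype_comap (measurableSet_singleton _).compl F, restrict_compl_singleton]
  have e2 := (volume : Measure E).measurePreserving_homeomorphUnitSphereProd.integral_comp
        (Homeomorph.measurableEmbedding _) G
  have i2 := (volume : Measure E).measurePreserving_homeomorphUnitSphereProd.integrable_comp_emb
        (Homeomorph.measurableEmbedding _) (g := G)
  have i1 : Integrable (fun x : ({0}ᶜ : Set E) => F x) ((volume : Measure E).comap Subtype.val) := by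
    have := (integrableOn_iff_comap_subtypeVal (μ := volume) (f := F)
      (measurableSet_singleton (0:E)).compl).1 hF.integrableOn
    exact this
  have hGc : G ∘ (homeomorphUnitSphereProd E) = fun x : ({0}ᶜ : Set E) => F x := funext hG
  rw [hGc] at i2
  have i3 := i2.1 i1
  simp only [hG] at e2
  rw [e1, e2, integral_prod _ i3]
  have hfr : Module.finrank ℝ E = d := by simp [E]
  rw [hfr] at i3 ⊢
  apply integral_eq_zero_of_ae
  filter_upwards [i3.prod_right_ae] with w hw
  have hw1 : ‖(w:E)‖ = 1 := by simp
  have hm : Measurable fun r : Set.Ioi (0:ℝ) => ENNReal.ofReal (r.1 ^ (d-1)) := by fun_prop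
  have key : IntegrableOn (fun r : ℝ => r ^ (d-1) * F (r • w.1)) (Set.Ioi 0) := by
    rw [Measure.volumeIoiPow, integrable_withDensity_iff_integrable_smul' hm (by simp)] at hw
    rw [integrableOn_iff_comap_subtypeVal measurableSet_Ioi]
    refine hw.congr (.of_forall ?_)
    rintro ⟨x, hx : 0 < x⟩
    simp (disch := positivity) [ENNReal.toReal_ofReal, G]
  have := h w hw1 key
  show ∫ r, G (w, r) ∂_ = 0
  refine Eq.trans ?_ this
  simp only [Measure.volumeIoiPow, ENNReal.ofReal]
  rw [integral_withDensity_eq_integral_smul,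
    integral_subtype_comap measurableSet_Ioi fun a ↦ Real.toNNReal (a ^ (d - 1)) • F (a • w.1)]
  · refine setIntegral_congr_fun measurableSet_Ioi fun x hx ↦ ?_
    rw [NNReal.smul_def, Real.coe_toNNReal _ (pow_nonneg hx.out.le _), smul_eq_mul]
  · exact (measurable_subtype_coe.pow_const _).real_toNNReal

lemma radial (d m : ℕ) (hd : 3 ≤ d) (l : ℝ) (hl : 0 < l)
    (ψ : SchwartzMap (EuclideanSpace ℝ (Fin d)) ℝ) (C : ℝ)
    (hC : ∀ x, |ψ x| ≤ C * gmin ‖x‖) :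
    (∫ x : EuclideanSpace ℝ (Fin d),
      ‖x‖ ^ (-(d : ℝ)) * (Real.log (‖x‖ / l)) ^ (m + 1) * fderiv ℝ (⇑ψ) x x)
    + ((m:ℝ)+1) * (∫ x : EuclideanSpace ℝ (Fin d),
      ‖x‖ ^ (-(d : ℝ)) * (Real.log (‖x‖ / l)) ^ m * ψ x) = 0 := by
  obtain ⟨C', hC'⟩ := euler_bd d ψ
  have i1 := int_main d (m+1) hd l hl (eul d ψ) (eul d ψ).continuous C' hC'
  have i2 := (int_main d m hd l hl ψ ψ.continuous C hC).const_mul ((m:ℝ)+1)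
  simp only [eul_apply] at i1
  rw [← integral_const_mul, ← integral_add i1 i2]
  apply polar_zero d hd _ (i1.add i2)
  intro w hw hint
  set f : ℝ → ℝ := fun r => Real.log (r / l) ^ (m+1) * ψ (r • w) with hf
  set f' : ℝ → ℝ := fun r => ((m:ℝ)+1) * Real.log (r/l) ^ m * r⁻¹ * ψ (r • w)
    + Real.log (r/l) ^ (m+1) * fderiv ℝ (⇑ψ) (r • w) w with hf'
  have hd1 : ∀ r ∈ Set.Ioi (0:ℝ), HasDerivAt f (f' r) r := by
    intro r hr
    have hr : 0 < r := hr
    have a1 : HasDerivAt (fun r : ℝ => Real.log (r / l)) (r⁻¹) r := by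
      have := ((hasDerivAt_id' r).div_const l).log (div_pos hr hl).ne'
      refine this.congr_deriv ?_
      field_simp
    have a2 := a1.pow (m+1)
    have a3 : HasDerivAt (fun r : ℝ => r • w) w r := by
      simpa using (hasDerivAt_id r).smul_const w
    have a4 := (ψ.differentiableAt (x := r • w)).hasFDerivAt.comp_hasDerivAt r a3
    have := a2.mul a4
    refine this.congr_deriv ?_
    simp [hf', Function.comp]
  have heq : ∀ r ∈ Set.Ioi (0:ℝ), r ^ (d-1) * (‖r • w‖ ^ (-(d : ℝ)) * (Real.log (‖r • w‖ / l)) ^ (m + 1) * fderiv ℝ (⇑ψ) (r • w) (r • w) + ((m:ℝ)+1) * (‖r • w‖ ^ (-(d : ℝ)) * (Real.log (‖r • w‖ / l)) ^ m * ψ (r • w))) = f' r := by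
    intro r hr
    have hr : 0 < r := hr
    have hn : ‖r • w‖ = r := by rw [norm_smul, hw, mul_one, Real.norm_of_nonneg hr.le]
    have : r⁻¹ = r ^ (d-1) * r ^ (-(d:ℝ)) := by
      rw [← Real.rpow_neg_one, ← Real.rpow_natCast, ← Real.rpow_add hr, Nat.cast_sub (by omega)]; congr 1; push_cast; ring
    have h2 : 1 = r ^ (d-1) * r ^ (-(d:ℝ)) * r := by rw [← this]; field_simp
    rw [hn, map_smul, smul_eq_mul, hf']
    beta_reduce
    rw [this]
    linear_combination (-(Real.log (r/l) ^ (m+1) * fderiv ℝ (⇑ψ) (r • w) w)) * h2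
  have hbd : ∀ r ∈ Set.Ioi (0:ℝ), ‖f r‖ ≤ C * (|Real.log (r / l)| ^ (m+1) * gmin r) := by
    intro r hr
    have hr : 0 < r := hr
    have hn : ‖r • w‖ = r := by rw [norm_smul, hw, mul_one, Real.norm_of_nonneg hr.le]
    have := hC (r • w)
    rw [hn] at this
    simp only [hf, norm_mul, norm_pow, Real.norm_eq_abs]
    calc _ ≤ |Real.log (r / l)| ^ (m+1) * (C * gmin r) := by gcongr
      _ = _ := by ring
  have t0 : Tendsto f (𝓝[>] 0) (𝓝 0) := by
    have h1 : Tendsto (fun t : ℝ => t ^ (-(-(1/2)) : ℝ)) (𝓝[>] 0) (𝓝 0) := by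
      have : ContinuousAt (fun t : ℝ => t ^ (-(-(1/2)) : ℝ)) 0 :=
        Real.continuousAt_rpow_const _ _ (Or.inr (by norm_num))
      have := this.tendsto.mono_left (nhdsWithin_le_nhds (s := Set.Ioi 0))
      rwa [Real.zero_rpow (by norm_num)] at this
    have h2 := ((lg_zero l hl (m+1)).trans_tendsto h1).const_mul C
    rw [mul_zero] at h2
    refine squeeze_zero_norm' ?_ h2
    filter_upwards [self_mem_nhdsWithin] with r hr using hbd r hr
  have t1 : Tendsto f atTop (𝓝 0) := by
    have h1 : Tendsto (fun t : ℝ => t ^ (-(1/2) : ℝ)) atTop (𝓝 0) :=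
      tendsto_rpow_neg_atTop (by norm_num)
    have h2 := ((lg_top l hl (m+1)).trans_tendsto h1).const_mul C
    rw [mul_zero] at h2
    refine squeeze_zero_norm' ?_ h2
    filter_upwards [eventually_gt_atTop 0] with r hr using hbd r hr
  have hint' : IntegrableOn f' (Set.Ioi 0) := hint.congr_fun heq measurableSet_Ioi
  have hc : ContinuousWithinAt f (Set.Ici 0) 0 := by
    have : f 0 = 0 := by simp [hf]
    rw [← Set.Ioi_insert, continuousWithinAt_insert_self, ContinuousWithinAt, this]
    exact t0
  have := integral_Ioi_of_hasDerivAt_of_tendsto hc hd1 hint' t1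
  refine (setIntegral_congr_fun measurableSet_Ioi heq).trans ?_
  rw [this]
  simp [hf]

/-- the Euler operator and the extension commute on
`r^{-d} log^m(r/l)` for `m ≥ 1`: pairing the renormalized distribution with
`d·φ + x·∇φ` gives `d ⟨R_m, φ⟩ - m ⟨R_{m-1}, φ⟩`, i.e.
`E R_d[r^{-d} log^m(r/l)] = -d R_d[r^{-d} log^m(r/l)] + m R_d[r^{-d} log^{m-1}(r/l)]`. -/
theorem stmt_1 (d m : ℕ) (hd : 3 ≤ d) (hm : 1 ≤ m) (l : ℝ) (hl : 0 < l)
    (φ : SchwartzMap (EuclideanSpace ℝ (Fin d)) ℝ) :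
    -(1 / ((m : ℝ) + 1)) *
        (∫ x : EuclideanSpace ℝ (Fin d),
          ‖x‖ ^ (-(d : ℝ)) * (Real.log (‖x‖ / l)) ^ (m + 1) *
            fderiv ℝ (fun y : EuclideanSpace ℝ (Fin d) =>
              (d : ℝ) * φ y + fderiv ℝ (⇑φ) y y) x x)
      = (d : ℝ) * (-(1 / ((m : ℝ) + 1)) *
            ∫ x : EuclideanSpace ℝ (Fin d),
              ‖x‖ ^ (-(d : ℝ)) * (Real.log (‖x‖ / l)) ^ (m + 1) * fderiv ℝ (⇑φ) x x)
        - (m : ℝ) * (-(1 / (m : ℝ)) *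
            ∫ x : EuclideanSpace ℝ (Fin d),
              ‖x‖ ^ (-(d : ℝ)) * (Real.log (‖x‖ / l)) ^ m * fderiv ℝ (⇑φ) x x) := by
  obtain ⟨C, hC⟩ := euler_bd d φ
  obtain ⟨C', hC'⟩ := euler_bd d (eul d φ)
  have key := radial d m hd l hl (eul d φ) C hC
  have i1 := (int_main d (m+1) hd l hl (eul d φ) (eul d φ).continuous C hC).const_mul (d:ℝ)
  have i2 := int_main d (m+1) hd l hl (eul d (eul d φ)) (eul d (eul d φ)).continuous C' hC'
  have e : ∀ x : EuclideanSpace ℝ (Fin d), ‖x‖ ^ (-(d : ℝ)) * (Real.log (‖x‖ / l)) ^ (m + 1) *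
            fderiv ℝ (fun y : EuclideanSpace ℝ (Fin d) =>
              (d : ℝ) * φ y + fderiv ℝ (⇑φ) y y) x x =
      (d:ℝ) * (‖x‖ ^ (-(d : ℝ)) * (Real.log (‖x‖ / l)) ^ (m + 1) * eul d φ x) +
      ‖x‖ ^ (-(d : ℝ)) * (Real.log (‖x‖ / l)) ^ (m + 1) * eul d (eul d φ) x := by
    intro x
    have h := ((φ.differentiableAt (x := x)).hasFDerivAt.const_mul (d:ℝ)).add
      ((eul d φ).differentiableAt (x := x)).hasFDerivAt
    have h' : fderiv ℝ (fun y : EuclideanSpace ℝ (Fin d) =>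
              (d : ℝ) * φ y + fderiv ℝ (⇑φ) y y) x = _ := h.fderiv
    rw [h']
    simp only [add_apply, smul_apply, smul_eq_mul, eul_apply]
    ring
  simp_rw [e]
  rw [integral_add i1 i2, integral_const_mul]
  simp only [eul_apply] at key ⊢
  have hm0 : (m:ℝ) ≠ 0 := by positivity
  have hm1 : (m:ℝ) + 1 ≠ 0 := by positivity
  field_simp
  linear_combination -key

end
end

section
/- Let l > 0. For every Schwartz function φ on ℝ^4 one has ∫_{ℝ^4} |x|^{−6} ( φ(x) − φ(0) − Σ_{i=1}^{4} x_i ∂_i φ(0) − θ(l−|x|) (1/2) Σ_{i,j=1}^{4} x_i x_j ∂_i ∂_j φ(0) ) dx = −(1/16) ∫_{ℝ^4} |x|^{−2} log(|x|/l) (Δ²φ)(x) dx + (5π²/16) (Δφ)(0), where θ is the Heaviside step function; both integrals are absolutely convergent. (This is the renormalization of the sunset amplitude: R_4[r^{−6}] = −(1/16) Δ²(r^{−2} log(r/l)) + (5π²/16) Δδ.) -/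
open MeasureTheory Real SchwartzMap

noncomputable section

/-- The Laplacian of a function on `ℝ^4`. -/
def lapl4 (f : EuclideanSpace ℝ (Fin 4) → ℝ) (x : EuclideanSpace ℝ (Fin 4)) : ℝ :=
  ∑ i : Fin 4,
    fderiv ℝ (fun y => fderiv ℝ f y (EuclideanSpace.single i 1)) x (EuclideanSpace.single i 1)

abbrev E4 := EuclideanSpace ℝ (Fin 4)

lemma polar4 (f : ℝ → ℝ) :
    ∫ x : E4, f ‖x‖ = 2 * π ^ 2 * ∫ r in Set.Ioi (0:ℝ), r ^ 3 * f r := by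
  rw [integral_fun_norm_addHaar (volume : Measure E4) f]
  have h : (volume : Measure E4).real (Metric.ball 0 1) = π ^ 2 / 2 := by
    rw [Measure.real, InnerProductSpace.volume_ball_of_dim_even (k := 2) (by simp)]
    simp [Nat.factorial]
    positivity
  simp only [h, finrank_euclideanSpace, Fintype.card_fin, nsmul_eq_mul, smul_eq_mul]
  norm_num
  ring

lemma integrable_polar4 (f : ℝ → ℝ) :
    Integrable (fun x : E4 => f ‖x‖) ↔ IntegrableOn (fun r => r ^ 3 * f r) (Set.Ioi (0:ℝ)) := by
  rw [integrable_fun_norm_addHaar (volume : Measure E4) (f := f)]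
  simp

lemma odd_lin_zero (g : ℝ → ℝ) (i j : Fin 4) (hij : i ≠ j) :
    ∫ x : E4, g ‖x‖ * (x i * x j) = 0 := by
  let e : E4 ≃ₗᵢ[ℝ] E4 := LinearIsometryEquiv.piLpCongrRight 2
    (fun k : Fin 4 => if k = i then LinearIsometryEquiv.neg ℝ else LinearIsometryEquiv.refl ℝ ℝ)
  have h := e.measurePreserving.integral_comp e.toHomeomorph.measurableEmbedding
    (fun x : E4 => g ‖x‖ * (x i * x j))
  have h1 : ∀ x : E4, (e x) i = - x i := by intro x; simp [e]
  have h2 : ∀ x : E4, (e x) j = x j := by intro x; simp [e, hij.symm]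
  simp only [LinearIsometryEquiv.norm_map, h1, h2] at h
  have h3 : ∫ x : E4, g ‖x‖ * (-x i * x j) = - ∫ x : E4, g ‖x‖ * (x i * x j) := by
    rw [← integral_neg]; congr 1; ext x; ring
  linarith

lemma sq_eq (g : ℝ → ℝ) (i j : Fin 4) :
    ∫ x : E4, g ‖x‖ * (x i * x i) = ∫ x : E4, g ‖x‖ * (x j * x j) := by
  let e : E4 ≃ₗᵢ[ℝ] E4 := LinearIsometryEquiv.piLpCongrLeft 2 ℝ ℝ (Equiv.swap i j)
  have h := e.measurePreserving.integral_comp e.toHomeomorph.measurableEmbedding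
    (fun x : E4 => g ‖x‖ * (x i * x i))
  have h1 : ∀ x : E4, (e x) i = x j := by
    intro x; simp [e, LinearIsometryEquiv.piLpCongrLeft_apply, Equiv.piCongrLeft']
  simp only [LinearIsometryEquiv.norm_map, h1] at h
  exact h.symm

lemma quad_int (g : ℝ → ℝ) (A : Fin 4 → Fin 4 → ℝ)
    (hg : ∀ i j, Integrable (fun x : E4 => g ‖x‖ * (x i * x j))) :
    ∫ x : E4, g ‖x‖ * (∑ i, ∑ j, x i * x j * A i j)
      = (∑ i, A i i) / 4 * (2 * π ^ 2 * ∫ r in Set.Ioi (0:ℝ), r ^ 5 * g r) := by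
  have hr : ∫ x : E4, g ‖x‖ * ‖x‖ ^ 2 = 2 * π ^ 2 * ∫ r in Set.Ioi (0:ℝ), r ^ 5 * g r := by
    rw [polar4 (fun r => g r * r ^ 2)]
    congr 2; ext r; ring
  have h4 : ∀ i, ∫ x : E4, g ‖x‖ * (x i * x i) = (∫ x : E4, g ‖x‖ * ‖x‖ ^ 2) / 4 := by
    intro i
    have : ∀ x : E4, g ‖x‖ * ‖x‖ ^ 2 = ∑ j, g ‖x‖ * (x j * x j) := by
      intro x
      rw [EuclideanSpace.real_norm_sq_eq, Finset.mul_sum]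
      simp [pow_two]
    simp_rw [this]
    rw [integral_finsetSum _ (fun j _ => hg j j)]
    rw [Finset.sum_congr rfl (fun j _ => sq_eq g j i)]
    simp
  have : ∀ x : E4, g ‖x‖ * (∑ i, ∑ j, x i * x j * A i j)
      = ∑ i, ∑ j, A i j * (g ‖x‖ * (x i * x j)) := by
    intro x
    simp only [Finset.mul_sum]
    refine Finset.sum_congr rfl fun i _ => Finset.sum_congr rfl fun j _ => by ring
  simp_rw [this]
  rw [integral_finsetSum _ (fun i _ => integrable_finsetSum _ (fun j _ => (hg i j).const_mul _))]
  simp_rw [fun i => integral_finsetSum (μ := (volume : Measure E4)) Finset.univ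
    (fun j _ => (hg i j).const_mul (A i j)), integral_const_mul]
  rw [← hr]
  have : ∀ i, ∑ j, A i j * ∫ x : E4, g ‖x‖ * (x i * x j)
      = A i i * ((∫ x : E4, g ‖x‖ * ‖x‖ ^ 2) / 4) := by
    intro i
    rw [Finset.sum_eq_single i, h4]
    · intro j _ hj; rw [odd_lin_zero g i j hj.symm, mul_zero]
    · simp
  simp_rw [this]
  rw [← Finset.sum_mul]
  ring

/-- dominating function -/
lemma int_dom (l a b : ℝ) (hl : 0 < l) (ha : -4 < a) (hb : b < -4) :
    Integrable (fun x : E4 => if ‖x‖ ≤ l then ‖x‖ ^ a else ‖x‖ ^ b) := by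
  rw [integrable_polar4 (fun r => if r ≤ l then r ^ a else r ^ b)]
  rw [← Set.Ioc_union_Ioi_eq_Ioi hl.le]
  refine IntegrableOn.union ?_ ?_
  · have : IntegrableOn (fun r : ℝ => r ^ (a + 3)) (Set.Ioc 0 l) := by
      rw [integrableOn_Ioc_iff_integrableOn_Ioo]
      exact (intervalIntegral.integrableOn_Ioo_rpow_iff hl).2 (by linarith)
    refine this.congr_fun ?_ measurableSet_Ioc
    intro r hr
    simp only [hr.2, if_true]
    rw [Real.rpow_add hr.1, mul_comm]
    norm_num
  · have : IntegrableOn (fun r : ℝ => r ^ (b + 3)) (Set.Ioi l) :=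
      integrableOn_Ioi_rpow_of_lt (by linarith) hl
    refine this.congr_fun ?_ measurableSet_Ioi
    intro r hr
    have hr' : 0 < r := hl.trans hr
    have hr2 : ¬ r ≤ l := not_le.2 (Set.mem_Ioi.1 hr)
    simp only [hr2, if_false]
    rw [Real.rpow_add hr', mul_comm]
    norm_num

lemma sum_lin (L : E4 →L[ℝ] ℝ) (x : E4) :
    ∑ i : Fin 4, x i * L (EuclideanSpace.single i 1) = L x := by
  conv_rhs => rw [← (EuclideanSpace.basisFun (Fin 4) ℝ).sum_repr x]
  simp [map_sum]

lemma sum_quad (φ : SchwartzMap E4 ℝ) (x : E4) :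
    ∑ i : Fin 4, ∑ j : Fin 4, x i * x j *
      fderiv ℝ (fun y => fderiv ℝ (⇑φ) y (EuclideanSpace.single j 1)) 0
        (EuclideanSpace.single i 1) = fderiv ℝ (fderiv ℝ (⇑φ)) 0 x x := by
  have hd : DifferentiableAt ℝ (fderiv ℝ (⇑φ)) 0 :=
    ((fderivCLM ℝ E4 ℝ φ).differentiableAt (x := 0))
  have h : ∀ j : Fin 4, fderiv ℝ (fun y => fderiv ℝ (⇑φ) y (EuclideanSpace.single j 1)) 0
      = (fderiv ℝ (fderiv ℝ (⇑φ)) 0).flip (EuclideanSpace.single j 1) := by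
    intro j
    rw [fderiv_clm_apply hd (by fun_prop)]
    simp
  simp_rw [h]
  rw [Finset.sum_comm]
  have : ∀ j : Fin 4, ∑ i : Fin 4, x i * x j *
      (fderiv ℝ (fderiv ℝ (⇑φ)) 0).flip (EuclideanSpace.single j 1) (EuclideanSpace.single i 1)
      = x j * (fderiv ℝ (fderiv ℝ (⇑φ)) 0 x) (EuclideanSpace.single j 1) := by
    intro j
    rw [← ContinuousLinearMap.flip_apply, ← sum_lin, Finset.mul_sum]
    exact Finset.sum_congr rfl fun i _ => by ring
  simp_rw [this]
  rw [sum_lin]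

lemma mv_aux {G : Type*} [NormedAddCommGroup G] [NormedSpace ℝ G] (f : E4 → G)
    (f' : E4 → E4 →L[ℝ] G) (hf : ∀ x, HasFDerivAt f (f' x) x) (hf0 : f 0 = 0) (C : ℝ) (n : ℕ)
    (hC : 0 ≤ C) (h : ∀ x, ‖f' x‖ ≤ C * ‖x‖ ^ n) (x : E4) : ‖f x‖ ≤ C * ‖x‖ ^ (n + 1) := by
  have := (convex_closedBall (0 : E4) ‖x‖).norm_image_sub_le_of_norm_hasFDerivWithin_le
    (f := f) (f' := f') (C := C * ‖x‖ ^ n) (x := 0) (y := x)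
    (fun y _ => (hf y).hasFDerivWithinAt) (fun y hy => (h y).trans (by
      have : ‖y‖ ≤ ‖x‖ := by simpa using hy
      gcongr)) (by simp) (by simp)
  simp only [hf0, sub_zero] at this
  rw [pow_succ]; linarith

lemma taylor3 (φ : SchwartzMap E4 ℝ) : ∃ C : ℝ, 0 ≤ C ∧ ∀ x : E4,
    |φ x - φ 0 - fderiv ℝ (⇑φ) 0 x - 1 / 2 * fderiv ℝ (fderiv ℝ (⇑φ)) 0 x x| ≤ C * ‖x‖ ^ 3 := by
  let φ1 := fderivCLM ℝ E4 ℝ φ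
  let φ2 := fderivCLM ℝ E4 _ φ1
  let φ3 := fderivCLM ℝ E4 _ φ2
  have e1 : ∀ x, HasFDerivAt φ (φ1 x) x := fun x => φ.hasFDerivAt x
  have e2 : ∀ x, HasFDerivAt φ1 (φ2 x) x := fun x => φ1.hasFDerivAt x
  have e3 : ∀ x, HasFDerivAt φ2 (φ3 x) x := fun x => φ2.hasFDerivAt x
  have hsymm : ∀ v w, φ2 0 v w = φ2 0 w v := by
    have := (φ.contDiffAt 2 (x := 0)).isSymmSndFDerivAt (by simp)
    intro v w
    exact this v w
  refine ⟨SchwartzMap.seminorm ℝ 0 0 φ3, by positivity, ?_⟩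
  set C := SchwartzMap.seminorm ℝ 0 0 φ3 with hCdef
  have hC : 0 ≤ C := by positivity
  have b2 := mv_aux (fun x => φ2 x - φ2 0) φ3 (fun x => (e3 x).sub_const _) (by simp) C 0 hC
    (fun x => by simpa using SchwartzMap.norm_le_seminorm ℝ φ3 x)
  have b1 := mv_aux (fun x => φ1 x - φ1 0 - φ2 0 x) (fun x => φ2 x - φ2 0)
    (fun x => ((e2 x).sub_const _).sub (φ2 0).hasFDerivAt) (by simp) C 1 hC b2
  have b0 := mv_aux (fun x => φ x - φ 0 - φ1 0 x - 1 / 2 * φ2 0 x x)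
    (fun x => φ1 x - φ1 0 - φ2 0 x)
    (fun x => by
      have hq : HasFDerivAt (fun x => 1 / 2 * φ2 0 x x) (φ2 0 x) x := by
        have := (((φ2 0).hasFDerivAt (x := x)).clm_apply (hasFDerivAt_id x)).const_mul (1 / 2 : ℝ)
        refine this.congr_fderiv ?_
        apply ContinuousLinearMap.ext
        intro v
        have hv := hsymm v x
        simp [hv]
        try ring
      exact (((e1 x).sub_const _).sub (φ1 0).hasFDerivAt).sub hq) (by simp) C 2 hC b1
  intro x
  exact b0 x

lemma taylor1 (φ : SchwartzMap E4 ℝ) (l : ℝ) (hl : 0 < l) : ∃ C : ℝ, 0 ≤ C ∧ ∀ x : E4, l < ‖x‖ →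
    |φ x - φ 0 - fderiv ℝ (⇑φ) 0 x| ≤ C * ‖x‖ := by
  set D := SchwartzMap.seminorm ℝ 0 0 φ
  have hD : 0 ≤ D := by positivity
  refine ⟨2 * D / l + ‖fderiv ℝ (⇑φ) 0‖, by positivity, fun x hx => ?_⟩
  have h1 := SchwartzMap.norm_le_seminorm ℝ φ x
  have h2 := SchwartzMap.norm_le_seminorm ℝ φ 0
  have h3 := (fderiv ℝ (⇑φ) 0).le_opNorm x
  have h4 : 2 * D ≤ 2 * D / l * ‖x‖ := by
    rw [div_mul_eq_mul_div, le_div_iff₀ hl]; gcongr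
  simp only [Real.norm_eq_abs] at h1 h2 h3
  have h5 := abs_sub (φ x - φ 0) (fderiv ℝ (⇑φ) 0 x)
  have h6 := abs_sub (φ x) (φ 0)
  linarith

lemma exists_lapl (φ : SchwartzMap E4 ℝ) : ∃ ψ : SchwartzMap E4 ℝ, lapl4 φ = ψ := by
  refine ⟨∑ i : Fin 4, LineDeriv.lineDerivOp (EuclideanSpace.single i (1:ℝ))
    (LineDeriv.lineDerivOp (EuclideanSpace.single i (1:ℝ)) φ), ?_⟩
  ext x
  rw [sum_apply]
  simp only [SchwartzMap.lineDerivOp_apply_eq_fderiv, lapl4]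
  refine Finset.sum_congr rfl fun i _ => ?_
  congr 2

def BddF (ε : ℝ) (F : ℝ → ℝ) : Prop := ∃ C, ∀ s, ε ≤ s → |F s| ≤ C

lemma BddF.add {ε : ℝ} {F G : ℝ → ℝ} (hF : BddF ε F) (hG : BddF ε G) :
    BddF ε (fun s => F s + G s) := by
  obtain ⟨C, hC⟩ := hF
  obtain ⟨D, hD⟩ := hG
  exact ⟨C + D, fun s hs => (abs_add_le _ _).trans (add_le_add (hC s hs) (hD s hs))⟩

lemma int_bdd (g : E4 → ℝ) (hg : Continuous g) (C : ℝ) (k : ℕ) (h : ∀ x, |g x| ≤ C * ‖x‖ ^ k)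
    (ψ : SchwartzMap E4 ℝ) : Integrable (fun x => g x * ψ x) := by
  refine ((ψ.integrable_pow_mul volume k).const_mul C).mono'
    (hg.mul ψ.continuous).aestronglyMeasurable (Filter.Eventually.of_forall fun x => ?_)
  rw [norm_mul, ← mul_assoc]
  gcongr
  exact h x

lemma ibp1 (g g' : E4 → ℝ) (i : Fin 4) (hg : Differentiable ℝ g)
    (hg' : ∀ x, fderiv ℝ g x (EuclideanSpace.single i 1) = g' x)
    (ψ : SchwartzMap E4 ℝ)
    (h1 : ∀ ψ : SchwartzMap E4 ℝ, Integrable (fun x => g x * ψ x))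
    (h2 : Integrable (fun x => g' x * ψ x)) :
    ∫ x, g x * fderiv ℝ ψ x (EuclideanSpace.single i 1) = - ∫ x, g' x * ψ x := by
  simp_rw [← hg']
  refine integral_mul_fderiv_eq_neg_fderiv_mul_of_integrable ?_ ?_ (h1 ψ)
    (fun x _ => hg x) (fun x _ => ψ.differentiableAt)
  · simpa only [hg'] using h2
  · exact h1 (LineDeriv.lineDerivOp (EuclideanSpace.single i (1:ℝ)) ψ)

lemma hasFDerivAt_rad (F F' : ℝ → ℝ) (ε : ℝ) (hε : 0 < ε)
    (hF : ∀ s, 0 < s → HasDerivAt F (F' s) s) (x : E4) :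
    HasFDerivAt (fun x : E4 => F (ε + ‖x‖ ^ 2)) ((2 * F' (ε + ‖x‖ ^ 2)) • innerSL ℝ x) x := by
  have h1 : HasFDerivAt (fun x : E4 => ε + ‖x‖ ^ 2) (2 • innerSL ℝ x) x :=
    (hasStrictFDerivAt_norm_sq x).hasFDerivAt.const_add ε
  have := (hF (ε + ‖x‖ ^ 2) (by positivity)).comp_hasFDerivAt x h1
  refine this.congr_fderiv ?_
  apply ContinuousLinearMap.ext
  intro v
  simp
  ring

lemma ibp2 (F F' F'' : ℝ → ℝ) (ε : ℝ) (hε : 0 < ε)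
    (hF : ∀ s, 0 < s → HasDerivAt F (F' s) s)
    (hF' : ∀ s, 0 < s → HasDerivAt F' (F'' s) s)
    (hF'' : ContinuousOn F'' (Set.Ioi 0))
    (bb0 : BddF ε F) (bb1 : BddF ε F') (bb2 : BddF ε F'') (ψ : SchwartzMap E4 ℝ) :
    ∫ x : E4, F (ε + ‖x‖ ^ 2) * lapl4 ψ x
      = ∫ x : E4, (4 * ‖x‖ ^ 2 * F'' (ε + ‖x‖ ^ 2) + 8 * F' (ε + ‖x‖ ^ 2)) * ψ x := by
  obtain ⟨C0, b0'⟩ := bb0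
  obtain ⟨C1, b1'⟩ := bb1
  obtain ⟨C2, b2'⟩ := bb2
  obtain ⟨C, b0, b1, b2⟩ : ∃ C, (∀ s, ε ≤ s → |F s| ≤ C) ∧ (∀ s, ε ≤ s → |F' s| ≤ C) ∧
      (∀ s, ε ≤ s → |F'' s| ≤ C) :=
    ⟨max C0 (max C1 C2), fun s hs => (b0' s hs).trans (by simp),
      fun s hs => (b1' s hs).trans (by simp), fun s hs => (b2' s hs).trans (by simp)⟩
  have hC : 0 ≤ C := (abs_nonneg _).trans (b0 ε le_rfl)
  have hs : ∀ x : E4, ε ≤ ε + ‖x‖ ^ 2 := fun x => by nlinarith [sq_nonneg ‖x‖]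
  have hs0 : ∀ x : E4, ε + ‖x‖ ^ 2 ∈ Set.Ioi (0:ℝ) := fun x => hε.trans_le (hs x)
  have d0 := hasFDerivAt_rad F F' ε hε hF
  have d1 := hasFDerivAt_rad F' F'' ε hε hF'
  have c0 : Continuous (fun x : E4 => F (ε + ‖x‖ ^ 2)) :=
    continuous_iff_continuousAt.2 fun x => (d0 x).continuousAt
  have c1 : Continuous (fun x : E4 => F' (ε + ‖x‖ ^ 2)) :=
    continuous_iff_continuousAt.2 fun x => (d1 x).continuousAt
  have c2 : Continuous (fun x : E4 => F'' (ε + ‖x‖ ^ 2)) :=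
    hF''.comp_continuous (by fun_prop) hs0
  have hxi : ∀ (x : E4) i, |x i| ≤ ‖x‖ := fun x i => by
    simpa using PiLp.norm_apply_le x i
  have cxi : ∀ i, Continuous (fun x : E4 => x i) := fun i => by fun_prop
  have i0 : ∀ ψ : SchwartzMap E4 ℝ, Integrable (fun x : E4 => F (ε + ‖x‖ ^ 2) * ψ x) := fun ψ =>
    int_bdd _ c0 C 0 (fun x => by simpa using b0 _ (hs x)) ψ
  have i1 : ∀ i, ∀ ψ : SchwartzMap E4 ℝ,
      Integrable (fun x : E4 => (2 * x i * F' (ε + ‖x‖ ^ 2)) * ψ x) := fun i ψ =>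
    int_bdd (fun x : E4 => 2 * x i * F' (ε + ‖x‖ ^ 2)) ((continuous_const.mul (cxi i)).mul c1) (2 * C) 1 (fun x => by
      rw [abs_mul, abs_mul, abs_two, pow_one]
      have := b1 _ (hs x)
      have := hxi x i
      calc 2 * |x i| * |F' (ε + ‖x‖ ^ 2)| ≤ 2 * ‖x‖ * C := by gcongr
        _ = _ := by ring) ψ
  have i2a : ∀ ψ : SchwartzMap E4 ℝ, Integrable (fun x : E4 => (2 * F' (ε + ‖x‖ ^ 2)) * ψ x) :=
    fun ψ => int_bdd (fun x : E4 => 2 * F' (ε + ‖x‖ ^ 2)) (continuous_const.mul c1) (2 * C) 0 (fun x => by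
      have := b1 _ (hs x)
      rw [abs_mul, abs_two, pow_zero, mul_one]; gcongr) ψ
  have i2b : ∀ i, ∀ ψ : SchwartzMap E4 ℝ,
      Integrable (fun x : E4 => (4 * x i ^ 2 * F'' (ε + ‖x‖ ^ 2)) * ψ x) := fun i ψ =>
    int_bdd (fun x : E4 => 4 * x i ^ 2 * F'' (ε + ‖x‖ ^ 2)) ((continuous_const.mul ((cxi i).pow 2)).mul c2) (4 * C) 2 (fun x => by
      rw [abs_mul, abs_mul, abs_pow, abs_of_pos (by norm_num : (0:ℝ) < 4)]
      have := b2 _ (hs x)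
      have := hxi x i
      calc 4 * |x i| ^ 2 * |F'' (ε + ‖x‖ ^ 2)| ≤ 4 * ‖x‖ ^ 2 * C := by gcongr
        _ = _ := by ring) ψ
  have i2 : ∀ i, ∀ ψ : SchwartzMap E4 ℝ,
      Integrable (fun x : E4 => (2 * F' (ε + ‖x‖ ^ 2) + 4 * x i ^ 2 * F'' (ε + ‖x‖ ^ 2)) * ψ x) :=
    fun i ψ => by
      refine ((i2a ψ).add (i2b i ψ)).congr (Filter.Eventually.of_forall fun x => ?_)
      simp only [Pi.add_apply]
      ring
  have e1 : ∀ i (x : E4), fderiv ℝ (fun x : E4 => F (ε + ‖x‖ ^ 2)) x (EuclideanSpace.single i 1)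
      = 2 * x i * F' (ε + ‖x‖ ^ 2) := by
    intro i x
    rw [(d0 x).fderiv]
    simp [EuclideanSpace.inner_single_right]
    ring
  have dd : ∀ i (x : E4), HasFDerivAt (fun x : E4 => 2 * x i * F' (ε + ‖x‖ ^ 2))
      ((2 * x i) • ((2 * F'' (ε + ‖x‖ ^ 2)) • innerSL ℝ x) +
        F' (ε + ‖x‖ ^ 2) • ((2:ℝ) • (EuclideanSpace.proj i : E4 →L[ℝ] ℝ))) x := by
    intro i x
    have hp : HasFDerivAt (fun x : E4 => 2 * x i) ((2:ℝ) • (EuclideanSpace.proj i : E4 →L[ℝ] ℝ)) x :=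
      ((EuclideanSpace.proj i : E4 →L[ℝ] ℝ).hasFDerivAt (x := x)).const_mul 2
    exact hp.mul (d1 x)
  have e2 : ∀ i (x : E4), fderiv ℝ (fun x : E4 => 2 * x i * F' (ε + ‖x‖ ^ 2)) x
      (EuclideanSpace.single i 1) = 2 * F' (ε + ‖x‖ ^ 2) + 4 * x i ^ 2 * F'' (ε + ‖x‖ ^ 2) := by
    intro i x
    rw [(dd i x).fderiv]
    simp [EuclideanSpace.inner_single_right]
    ring
  have key : ∀ i : Fin 4, ∫ x : E4, F (ε + ‖x‖ ^ 2) *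
      fderiv ℝ (fun y => fderiv ℝ ψ y (EuclideanSpace.single i 1)) x (EuclideanSpace.single i 1)
      = ∫ x : E4, (2 * F' (ε + ‖x‖ ^ 2) + 4 * x i ^ 2 * F'' (ε + ‖x‖ ^ 2)) * ψ x := by
    intro i
    have A := ibp1 _ _ i (fun x => (d0 x).differentiableAt) (e1 i)
      (LineDeriv.lineDerivOp (EuclideanSpace.single i (1:ℝ)) ψ) i0 (i1 i _)
    have B := ibp1 _ _ i (fun x => (dd i x).differentiableAt) (e2 i) ψ (i1 i) (i2 i _)
    have hL : ⇑(LineDeriv.lineDerivOp (EuclideanSpace.single i (1:ℝ)) ψ)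
      = fun y => fderiv ℝ ψ y (EuclideanSpace.single i 1) := by
      ext y; exact SchwartzMap.lineDerivOp_apply_eq_fderiv _ _ _
    rw [hL] at A
    rw [A, B, neg_neg]
  have hint : ∀ i : Fin 4, Integrable (fun x : E4 => F (ε + ‖x‖ ^ 2) *
      fderiv ℝ (fun y => fderiv ℝ ψ y (EuclideanSpace.single i 1)) x (EuclideanSpace.single i 1)) := by
    intro i
    exact i0 (LineDeriv.lineDerivOp (EuclideanSpace.single i (1:ℝ))
      (LineDeriv.lineDerivOp (EuclideanSpace.single i (1:ℝ)) ψ))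
  simp only [lapl4, Finset.mul_sum]
  rw [integral_finsetSum _ (fun i _ => hint i), Finset.sum_congr rfl (fun i _ => key i),
    ← integral_finsetSum _ (fun i _ => i2 i ψ)]
  congr 1
  ext x
  rw [← Finset.sum_mul, Finset.sum_add_distrib, ← Finset.sum_mul (f := fun i => 4 * x i ^ 2),
    ← Finset.mul_sum (f := fun i => x i ^ 2), ← EuclideanSpace.real_norm_sq_eq]
  simp only [Finset.sum_const, Finset.card_univ, Fintype.card_fin, nsmul_eq_mul]
  push_cast
  ring

def LL (l s : ℝ) : ℝ := Real.log s - 2 * Real.log l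
def F0 (l s : ℝ) : ℝ := LL l s / (2 * s)
def F0' (l s : ℝ) : ℝ := (1 - LL l s) / (2 * s ^ 2)
def F0'' (l s : ℝ) : ℝ := (2 * LL l s - 3) / (2 * s ^ 3)
def F1 (l ε s : ℝ) : ℝ := -2 / s ^ 2 + ε * (6 - 4 * LL l s) / s ^ 3
def F1' (l ε s : ℝ) : ℝ := 4 / s ^ 3 + ε * (12 * LL l s - 22) / s ^ 4
def F1'' (l ε s : ℝ) : ℝ := -12 / s ^ 4 + ε * (100 - 48 * LL l s) / s ^ 5
def F2 (l ε s : ℝ) : ℝ :=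
  -16 / s ^ 3 + ε * (272 - 96 * LL l s) / s ^ 4 + ε ^ 2 * (192 * LL l s - 400) / s ^ 5

lemma hasDerivAt_LL (l s : ℝ) (hs : 0 < s) : HasDerivAt (LL l) (1 / s) s := by
  rw [one_div]
  exact (Real.hasDerivAt_log hs.ne').sub_const (2 * Real.log l)

lemma hasDerivAt_gen (l a b : ℝ) (k : ℕ) (s : ℝ) (hs : 0 < s) :
    HasDerivAt (fun s => (a + b * LL l s) / s ^ k)
      ((b - k * (a + b * LL l s)) / s ^ (k + 1)) s := by
  have h1 := (((hasDerivAt_LL l s hs).const_mul b).const_add a).div (hasDerivAt_pow k s)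
    (pow_ne_zero k hs.ne')
  refine h1.congr_deriv ?_
  rcases k with _ | k
  · simp; field_simp
  · push_cast
    field_simp
    try ring

lemma hF0 (l s : ℝ) (hs : 0 < s) : HasDerivAt (F0 l) (F0' l s) s := by
  have := hasDerivAt_gen l 0 (1/2) 1 s hs
  refine (this.congr_deriv ?_).congr_of_eventuallyEq (Filter.Eventually.of_forall fun t => ?_)
  · simp only [F0']; push_cast; field_simp; ring
  · simp only [F0]; ring

lemma hF0' (l s : ℝ) (hs : 0 < s) : HasDerivAt (F0' l) (F0'' l s) s := by
  have := hasDerivAt_gen l (1/2) (-1/2) 2 s hs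
  refine (this.congr_deriv ?_).congr_of_eventuallyEq (Filter.Eventually.of_forall fun t => ?_)
  · simp only [F0'']; push_cast; field_simp; ring
  · simp only [F0']; ring

lemma hF1 (l ε s : ℝ) (hs : 0 < s) : HasDerivAt (F1 l ε) (F1' l ε s) s := by
  have := (hasDerivAt_gen l (-2) 0 2 s hs).add (hasDerivAt_gen l (6 * ε) (-4 * ε) 3 s hs)
  refine (this.congr_deriv ?_).congr_of_eventuallyEq (Filter.Eventually.of_forall fun t => ?_)
  · simp only [F1']; push_cast; field_simp; ring
  · simp only [F1, Pi.add_apply]; ring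

lemma hF1' (l ε s : ℝ) (hs : 0 < s) : HasDerivAt (F1' l ε) (F1'' l ε s) s := by
  have := (hasDerivAt_gen l 4 0 3 s hs).add (hasDerivAt_gen l (-22 * ε) (12 * ε) 4 s hs)
  refine (this.congr_deriv ?_).congr_of_eventuallyEq (Filter.Eventually.of_forall fun t => ?_)
  · simp only [F1'']; push_cast; field_simp; ring
  · simp only [F1', Pi.add_apply]; ring

lemma eF1 (l ε r : ℝ) (hε : 0 < ε) :
    4 * r ^ 2 * F0'' l (ε + r ^ 2) + 8 * F0' l (ε + r ^ 2) = F1 l ε (ε + r ^ 2) := by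
  have hs : ε + r ^ 2 ≠ 0 := by positivity
  generalize hS : ε + r ^ 2 = s at *
  have : r ^ 2 = s - ε := by linarith
  rw [this, F0'', F0', F1]
  field_simp
  ring

lemma eF2 (l ε r : ℝ) (hε : 0 < ε) :
    4 * r ^ 2 * F1'' l ε (ε + r ^ 2) + 8 * F1' l ε (ε + r ^ 2) = F2 l ε (ε + r ^ 2) := by
  have hs : ε + r ^ 2 ≠ 0 := by positivity
  generalize hS : ε + r ^ 2 = s at *
  have : r ^ 2 = s - ε := by linarith
  rw [this, F1'', F1', F2]
  field_simp
  ring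

lemma contOn_LL (l : ℝ) : ContinuousOn (LL l) (Set.Ioi 0) := fun s hs =>
  (hasDerivAt_LL l s hs).continuousAt.continuousWithinAt

lemma contOn_gen (l a b : ℝ) (k : ℕ) :
    ContinuousOn (fun s => (a + b * LL l s) / s ^ k) (Set.Ioi 0) := fun s hs =>
  (hasDerivAt_gen l a b k s hs).continuousAt.continuousWithinAt

lemma contOn_F0'' (l : ℝ) : ContinuousOn (F0'' l) (Set.Ioi 0) := by
  refine (contOn_gen l (-3/2) 1 3).congr fun s hs => ?_
  simp only [F0'']; ring

lemma contOn_F1'' (l ε : ℝ) : ContinuousOn (F1'' l ε) (Set.Ioi 0) := by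
  refine ((contOn_gen l (-12) 0 4).add (contOn_gen l (100 * ε) (-48 * ε) 5)).congr fun s hs => ?_
  simp only [F1'', Pi.add_apply]; ring

lemma contOn_F2 (l ε : ℝ) : ContinuousOn (F2 l ε) (Set.Ioi 0) := by
  refine (((contOn_gen l (-16) 0 3).add (contOn_gen l (272 * ε) (-96 * ε) 4)).add
    (contOn_gen l (-400 * ε ^ 2) (192 * ε ^ 2) 5)).congr fun s hs => ?_
  simp only [F2, Pi.add_apply]; ring

lemma bdd_gen (l ε a b : ℝ) (hε : 0 < ε) (k : ℕ) :
    BddF ε (fun s => (a + b * LL l s) / s ^ (k + 1)) := by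
  refine ⟨(|a| + |b| * (|Real.log ε| + 2 * |Real.log l|)) / ε ^ (k + 1) + |b| / ε ^ k,
    fun s hs => ?_⟩
  have hs0 : 0 < s := hε.trans_le hs
  have hlog : |Real.log s| ≤ |Real.log ε| + s := by
    rw [abs_le]
    have h1 := Real.log_le_log hε hs
    have h2 := Real.log_le_self hs0.le
    constructor
    · linarith [neg_abs_le (Real.log ε)]
    · linarith [abs_nonneg (Real.log ε)]
  have hLL : |LL l s| ≤ |Real.log ε| + 2 * |Real.log l| + s := by
    have := abs_sub (Real.log s) (2 * Real.log l)
    rw [abs_mul, abs_two] at this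
    simp only [LL]; linarith
  have hnum : |a + b * LL l s| ≤ (|a| + |b| * (|Real.log ε| + 2 * |Real.log l|)) + |b| * s := by
    calc |a + b * LL l s| ≤ |a| + |b| * |LL l s| := by
          rw [← abs_mul]; exact abs_add_le _ _
      _ ≤ |a| + |b| * (|Real.log ε| + 2 * |Real.log l| + s) := by gcongr
      _ = _ := by ring
  rw [abs_div, abs_of_pos (pow_pos hs0 (k + 1))]
  calc |a + b * LL l s| / s ^ (k + 1)
      ≤ ((|a| + |b| * (|Real.log ε| + 2 * |Real.log l|)) + |b| * s) / s ^ (k + 1) := by gcongr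
    _ = (|a| + |b| * (|Real.log ε| + 2 * |Real.log l|)) / s ^ (k + 1) + |b| / s ^ k := by
        field_simp; ring
    _ ≤ _ := by gcongr

lemma BddF.congr {ε : ℝ} {F G : ℝ → ℝ} (hF : BddF ε F) (h : ∀ s, G s = F s) : BddF ε G := by
  have : G = F := funext h
  rwa [this]

lemma biharm_ibp (l ε : ℝ) (hε : 0 < ε) (φ : SchwartzMap E4 ℝ) :
    ∫ x : E4, F0 l (ε + ‖x‖ ^ 2) * lapl4 (lapl4 φ) x = ∫ x : E4, F2 l ε (ε + ‖x‖ ^ 2) * φ x := by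
  obtain ⟨ψ, hψ⟩ := exists_lapl φ
  rw [hψ, ibp2 (F0 l) (F0' l) (F0'' l) ε hε (hF0 l) (hF0' l) (contOn_F0'' l)
    ((bdd_gen l ε 0 (1/2) hε 0).congr fun s => by simp only [F0]; ring)
    ((bdd_gen l ε (1/2) (-1/2) hε 1).congr fun s => by simp only [F0']; ring)
    ((bdd_gen l ε (-3/2) 1 hε 2).congr fun s => by simp only [F0'']; ring) ψ]
  simp_rw [eF1 l ε _ hε]
  rw [← hψ, ibp2 (F1 l ε) (F1' l ε) (F1'' l ε) ε hε (hF1 l ε) (hF1' l ε) (contOn_F1'' l ε)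
    (((bdd_gen l ε (-2) 0 hε 1).add (bdd_gen l ε (6 * ε) (-4 * ε) hε 2)).congr
      fun s => by simp only [F1]; ring)
    (((bdd_gen l ε 4 0 hε 2).add (bdd_gen l ε (-22 * ε) (12 * ε) hε 3)).congr
      fun s => by simp only [F1']; ring)
    (((bdd_gen l ε (-12) 0 hε 3).add (bdd_gen l ε (100 * ε) (-48 * ε) hε 4)).congr
      fun s => by simp only [F1'']; ring) φ]
  simp_rw [eF2 l ε _ hε]

lemma abs_log_le (s : ℝ) (hs : 0 < s) :
    |Real.log s| ≤ 4 * (s ^ (1/4 : ℝ) + s ^ (-(1/4) : ℝ)) := by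
  have h1 := Real.log_le_rpow_div hs.le (by norm_num : (0:ℝ) < 1/4)
  have h2 := Real.log_le_rpow_div (inv_nonneg.2 hs.le) (by norm_num : (0:ℝ) < 1/4)
  rw [Real.log_inv, Real.inv_rpow hs.le, ← Real.rpow_neg hs.le] at h2
  have h3 := Real.rpow_nonneg hs.le (1/4 : ℝ)
  have h4 := Real.rpow_nonneg hs.le (-(1/4) : ℝ)
  rw [abs_le]
  constructor <;> linarith

lemma one_le_w (s : ℝ) (hs : 0 < s) : 1 ≤ s ^ (1/4 : ℝ) + s ^ (-(1/4) : ℝ) := by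
  have h3 := Real.rpow_nonneg hs.le (1/4 : ℝ)
  have h4 := Real.rpow_nonneg hs.le (-(1/4) : ℝ)
  rcases le_total 1 s with h | h
  · linarith [Real.one_le_rpow h (by norm_num : (0:ℝ) ≤ 1/4)]
  · linarith [Real.one_le_rpow_of_pos_of_le_one_of_nonpos hs h (by norm_num : (-(1/4):ℝ) ≤ 0)]

lemma abs_LL_le (l s : ℝ) (hs : 0 < s) :
    |LL l s| ≤ (4 + 2 * |Real.log l|) * (s ^ (1/4 : ℝ) + s ^ (-(1/4) : ℝ)) := by
  have h1 := abs_log_le s hs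
  have h2 := one_le_w s hs
  have h3 := abs_sub (Real.log s) (2 * Real.log l)
  rw [abs_mul, abs_two] at h3
  have h4 := abs_nonneg (Real.log l)
  simp only [LL]
  nlinarith

lemma w_le (ε r : ℝ) (hε : 0 ≤ ε) (hr : 0 < r) (k : ℕ) (hk : 1 ≤ k) :
    ((ε + r ^ 2) ^ (1/4 : ℝ) + (ε + r ^ 2) ^ (-(1/4) : ℝ)) / (ε + r ^ 2) ^ k
      ≤ r ^ (-(2 * k : ℝ) + 1/2) + r ^ (-(2 * k : ℝ) - 1/2) := by
  have hk' : (1:ℝ) ≤ k := by exact_mod_cast hk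
  have hs : 0 < ε + r ^ 2 := by positivity
  have h : ∀ p : ℝ, p ≤ 0 → (ε + r ^ 2) ^ p ≤ r ^ (2 * p) := by
    intro p hp
    rw [Real.rpow_mul hr.le]
    refine Real.rpow_le_rpow_of_nonpos (by positivity) ?_ hp
    norm_cast
    linarith
  have e : ∀ p : ℝ, (ε + r ^ 2) ^ p / (ε + r ^ 2) ^ k = (ε + r ^ 2) ^ (p - k) := by
    intro p
    rw [Real.rpow_sub hs, Real.rpow_natCast]
  rw [add_div, e, e]
  have h1 := h (1/4 - k) (by linarith)
  have h2 := h (-(1/4) - k) (by linarith)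
  have e1 : 2 * (1/4 - (k:ℝ)) = -(2 * k : ℝ) + 1/2 := by ring
  have e2 : 2 * (-(1/4) - (k:ℝ)) = -(2 * k : ℝ) - 1/2 := by ring
  rw [e1] at h1
  rw [e2] at h2
  linarith

lemma F0_bound (l ε r : ℝ) (hε : 0 ≤ ε) (hr : 0 < r) :
    |F0 l (ε + r ^ 2)| ≤ (4 + 2 * |Real.log l|) * (r ^ (-(3/2) : ℝ) + r ^ (-(5/2) : ℝ)) := by
  have hs : 0 < ε + r ^ 2 := by positivity
  have h := w_le ε r hε hr 1 le_rfl
  have hL := abs_LL_le l _ hs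
  have e1 : (-(2 * (1:ℕ) : ℝ) + 1/2) = -(3/2) := by norm_num
  have e2 : (-(2 * (1:ℕ) : ℝ) - 1/2) = -(5/2) := by norm_num
  rw [e1, e2, pow_one] at h
  rw [F0, abs_div, abs_of_pos (by positivity : 0 < 2 * (ε + r ^ 2))]
  calc |LL l (ε + r ^ 2)| / (2 * (ε + r ^ 2)) ≤ |LL l (ε + r ^ 2)| / (ε + r ^ 2) := by
        gcongr; linarith
    _ ≤ (4 + 2 * |Real.log l|) * ((ε + r ^ 2) ^ (1/4 : ℝ) + (ε + r ^ 2) ^ (-(1/4) : ℝ))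
          / (ε + r ^ 2) := by gcongr
    _ = (4 + 2 * |Real.log l|) * (((ε + r ^ 2) ^ (1/4 : ℝ) + (ε + r ^ 2) ^ (-(1/4) : ℝ))
          / (ε + r ^ 2)) := by ring
    _ ≤ _ := by gcongr

lemma F2_bound (l ε r : ℝ) (hε : 0 ≤ ε) (hr : 0 < r) :
    |F2 l ε (ε + r ^ 2)| ≤ (688 + 288 * (4 + 2 * |Real.log l|)) *
      (r ^ (-(11/2) : ℝ) + r ^ (-(13/2) : ℝ)) := by
  have hs : 0 < ε + r ^ 2 := by positivity
  have h := w_le ε r hε hr 3 (by norm_num)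
  have hL := abs_LL_le l _ hs
  have e1 : (-(2 * (3:ℕ) : ℝ) + 1/2) = -(11/2) := by norm_num
  have e2 : (-(2 * (3:ℕ) : ℝ) - 1/2) = -(13/2) := by norm_num
  rw [e1, e2] at h
  have hw := one_le_w _ hs
  have hes : ε ≤ ε + r ^ 2 := by nlinarith
  rw [F2]
  generalize ε + r ^ 2 = s at *
  generalize s ^ (1/4 : ℝ) + s ^ (-(1/4) : ℝ) = w at *
  generalize 4 + 2 * |Real.log l| = K at *
  generalize LL l s = L at *
  have he0 : 0 ≤ ε / s := by positivity
  have he1 : ε / s ≤ 1 := by rw [div_le_one hs]; exact hes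
  have hid : -16 / s ^ 3 + ε * (272 - 96 * L) / s ^ 4 + ε ^ 2 * (192 * L - 400) / s ^ 5
      = (-16 + (ε / s) * (272 - 96 * L) + (ε / s) ^ 2 * (192 * L - 400)) / s ^ 3 := by
    field_simp
  have hK : 0 ≤ 688 + 288 * K := by
    have : 0 ≤ K * w := (abs_nonneg _).trans hL
    have : 0 ≤ K := by
      by_contra hc
      nlinarith
    linarith
  have hN : |-16 + (ε / s) * (272 - 96 * L) + (ε / s) ^ 2 * (192 * L - 400)| ≤ 688 + 288 * |L| := by
    have he2 : (ε / s) ^ 2 ≤ 1 := pow_le_one₀ he0 he1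
    have t1 : |272 - 96 * L| ≤ 272 + 96 * |L| := by
      have := abs_sub 272 (96 * L)
      rw [abs_mul, abs_of_pos (by norm_num : (0:ℝ) < 272),
        abs_of_pos (by norm_num : (0:ℝ) < 96)] at this
      exact this
    have t2 : |192 * L - 400| ≤ 192 * |L| + 400 := by
      have := abs_sub (192 * L) 400
      rw [abs_mul, abs_of_pos (by norm_num : (0:ℝ) < 400),
        abs_of_pos (by norm_num : (0:ℝ) < 192)] at this
      exact this
    have t3 : |(ε / s) * (272 - 96 * L)| ≤ 1 * (272 + 96 * |L|) := by
      rw [abs_mul, abs_of_nonneg he0]; gcongr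
    have t4 : |(ε / s) ^ 2 * (192 * L - 400)| ≤ 1 * (192 * |L| + 400) := by
      rw [abs_mul, abs_of_nonneg (sq_nonneg (ε / s))]; gcongr
    have t5 := abs_add_three (-16) ((ε / s) * (272 - 96 * L)) ((ε / s) ^ 2 * (192 * L - 400))
    have t6 : |(-16 : ℝ)| = 16 := by norm_num
    linarith
  rw [hid, abs_div, abs_of_pos (pow_pos hs 3)]
  calc _ ≤ (688 + 288 * |L|) / s ^ 3 := by gcongr
    _ ≤ ((688 + 288 * K) * w) / s ^ 3 := by
        gcongr
        nlinarith
    _ = (688 + 288 * K) * (w / s ^ 3) := by ring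
    _ ≤ _ := by gcongr

lemma H_deriv (l ε r : ℝ) (hε : 0 < ε) :
    HasDerivAt (fun r => 2 * r ^ 6 * F1' l ε (ε + r ^ 2) - 2 * r ^ 4 * F1 l ε (ε + r ^ 2)
      + 16 * r ^ 4 * F0' l (ε + r ^ 2)) (r ^ 5 * F2 l ε (ε + r ^ 2)) r := by
  have hs : 0 < ε + r ^ 2 := by positivity
  have hsq : HasDerivAt (fun r : ℝ => ε + r ^ 2) (2 * r) r := by
    simpa using (hasDerivAt_pow 2 r).const_add ε
  have a := (hF1' l ε _ hs).comp r hsq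
  have b := (hF1 l ε _ hs).comp r hsq
  have c := (hF0' l _ hs).comp r hsq
  have p6 : HasDerivAt (fun r : ℝ => 2 * r ^ 6) (12 * r ^ 5) r :=
    ((hasDerivAt_pow 6 r).const_mul 2).congr_deriv (by norm_num; ring)
  have p4 : HasDerivAt (fun r : ℝ => 2 * r ^ 4) (8 * r ^ 3) r :=
    ((hasDerivAt_pow 4 r).const_mul 2).congr_deriv (by norm_num; ring)
  have p4' : HasDerivAt (fun r : ℝ => 16 * r ^ 4) (64 * r ^ 3) r :=
    ((hasDerivAt_pow 4 r).const_mul 16).congr_deriv (by norm_num; ring)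
  refine (((p6.mul a).sub (p4.mul b)).add (p4'.mul c)).congr_deriv ?_
  simp only [Function.comp]
  rw [← eF2 l ε r hε, ← eF1 l ε r hε]
  ring

lemma G_deriv (l ε r : ℝ) (hε : 0 < ε) :
    HasDerivAt (fun r => 2 * r ^ 4 * F1' l ε (ε + r ^ 2)) (r ^ 3 * F2 l ε (ε + r ^ 2)) r := by
  have hs : 0 < ε + r ^ 2 := by positivity
  have hsq : HasDerivAt (fun r : ℝ => ε + r ^ 2) (2 * r) r := by
    simpa using (hasDerivAt_pow 2 r).const_add ε
  have a := (hF1' l ε _ hs).comp r hsq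
  have p4 : HasDerivAt (fun r : ℝ => 2 * r ^ 4) (8 * r ^ 3) r :=
    ((hasDerivAt_pow 4 r).const_mul 2).congr_deriv (by norm_num; ring)
  refine (p4.mul a).congr_deriv ?_
  simp only [Function.comp]
  rw [← eF2 l ε r hε]
  ring

lemma cont_F2 (l ε : ℝ) (hε : 0 < ε) : Continuous (fun r : ℝ => F2 l ε (ε + r ^ 2)) :=
  (contOn_F2 l ε).comp_continuous (by fun_prop) (fun r => by
    show 0 < ε + r ^ 2
    positivity)

lemma G_tendsto (l ε : ℝ) (hε : 0 < ε) :
    Filter.Tendsto (fun r : ℝ => 2 * r ^ 4 * F1' l ε (ε + r ^ 2)) Filter.atTop (nhds 0) := by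
  obtain ⟨C, hC⟩ := (bdd_gen l ε (-22 * ε) (12 * ε) hε 0).add
    (⟨4, fun s hs => by norm_num⟩ : BddF ε fun _ => 4)
  have hlim : Filter.Tendsto (fun r : ℝ => 2 * C * (r ^ 2)⁻¹) Filter.atTop (nhds 0) := by
    have := (tendsto_inv_atTop_zero.comp
      (Filter.tendsto_pow_atTop (α := ℝ) (two_ne_zero))).const_mul (2 * C)
    simpa [Function.comp_def] using this
  refine squeeze_zero_norm' ?_ hlim
  filter_upwards [Filter.eventually_gt_atTop 0] with r hr
  have hs : 0 < ε + r ^ 2 := by positivity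
  have hrs : r ^ 2 ≤ ε + r ^ 2 := by linarith
  have h := hC (ε + r ^ 2) (by nlinarith)
  have hC0 : 0 ≤ C := (abs_nonneg _).trans h
  have hr4 : r ^ 4 = (r ^ 2) ^ 2 := by ring
  rw [F1', Real.norm_eq_abs, hr4]
  have hr2 : 0 < r ^ 2 := by positivity
  generalize r ^ 2 = q at *
  generalize ε + q = s at *
  have e : 4 / s ^ 3 + ε * (12 * LL l s - 22) / s ^ 4
      = ((-22 * ε + 12 * ε * LL l s) / s ^ (0 + 1) + 4) / s ^ 3 := by
    field_simp
    ring
  rw [e, abs_mul, abs_div, abs_of_pos (pow_pos hs 3), abs_of_pos (by positivity : 0 < 2 * q ^ 2)]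
  calc _ ≤ 2 * q ^ 2 * (C / q ^ 3) := by gcongr
    _ = _ := by field_simp

lemma int_F2 (l ε : ℝ) (hε : 0 < ε) : ∫ x : E4, F2 l ε (ε + ‖x‖ ^ 2) = 0 := by
  rw [polar4 (fun r => F2 l ε (ε + r ^ 2))]
  by_cases hI : IntegrableOn (fun r => r ^ 3 * F2 l ε (ε + r ^ 2)) (Set.Ioi (0:ℝ))
  · rw [integral_Ioi_of_hasDerivAt_of_tendsto' (fun r _ => G_deriv l ε r hε) hI (G_tendsto l ε hε)]
    simp
  · rw [integral_undef hI, mul_zero]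

lemma int_H (l ε : ℝ) (hl : 0 < l) (hε : 0 < ε) :
    ∫ r in Set.Ioi (0:ℝ), r ^ 5 * (F2 l ε (ε + r ^ 2) * (if r ≤ l then 1 else 0)) =
      2 * l ^ 6 * F1' l ε (ε + l ^ 2) - 2 * l ^ 4 * F1 l ε (ε + l ^ 2)
      + 16 * l ^ 4 * F0' l (ε + l ^ 2) := by
  have h1 : ∫ r in (0:ℝ)..l, r ^ 5 * F2 l ε (ε + r ^ 2) =
      2 * l ^ 6 * F1' l ε (ε + l ^ 2) - 2 * l ^ 4 * F1 l ε (ε + l ^ 2)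
      + 16 * l ^ 4 * F0' l (ε + l ^ 2) := by
    rw [intervalIntegral.integral_eq_sub_of_hasDerivAt (fun r _ => H_deriv l ε r hε)
      (((continuous_pow 5).mul (cont_F2 l ε hε)).intervalIntegrable _ _)]
    simp
  rw [← h1, intervalIntegral.integral_of_le hl.le]
  have h2 : Set.Ioc 0 l = Set.Ioi 0 ∩ Set.Iic l := by ext; simp
  rw [h2, ← setIntegral_indicator measurableSet_Iic]
  congr 1
  ext r
  by_cases h : r ≤ l <;> simp [Set.indicator, h]

lemma H_tendsto (l : ℝ) (hl : 0 < l) :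
    Filter.Tendsto (fun ε => 2 * l ^ 6 * F1' l ε (ε + l ^ 2) - 2 * l ^ 4 * F1 l ε (ε + l ^ 2)
      + 16 * l ^ 4 * F0' l (ε + l ^ 2)) (nhdsWithin 0 (Set.Ioi 0)) (nhds 20) := by
  have hl2 : l ^ 2 ≠ 0 := by positivity
  have hc : ContinuousAt (fun ε => 2 * l ^ 6 * F1' l ε (ε + l ^ 2) - 2 * l ^ 4 * F1 l ε (ε + l ^ 2)
      + 16 * l ^ 4 * F0' l (ε + l ^ 2)) 0 := by
    simp only [F1', F1, F0', LL]
    fun_prop (disch := simp [hl.ne'])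
  have h0 : 2 * l ^ 6 * F1' l 0 (0 + l ^ 2) - 2 * l ^ 4 * F1 l 0 (0 + l ^ 2)
      + 16 * l ^ 4 * F0' l (0 + l ^ 2) = 20 := by
    have : LL l (l ^ 2) = 0 := by simp [LL]
    simp only [F1', F1, F0', zero_add, this]
    field_simp
    ring
  have := hc.tendsto
  simp only [h0] at this
  exact this.mono_left nhdsWithin_le_nhds

def Rm (φ : SchwartzMap E4 ℝ) (l : ℝ) (x : E4) : ℝ :=
  φ x - φ 0 - fderiv ℝ φ 0 x
    - (if ‖x‖ ≤ l then (1 : ℝ) else 0) * ((1 : ℝ) / 2) * fderiv ℝ (fderiv ℝ φ) 0 x x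

lemma ae_ne0 : ∀ᵐ x : E4, x ≠ 0 := by
  rw [ae_iff]
  simp

lemma Rm_bound (φ : SchwartzMap E4 ℝ) (l : ℝ) (hl : 0 < l) :
    ∃ C, 0 ≤ C ∧ ∀ x, |Rm φ l x| ≤ C * (if ‖x‖ ≤ l then ‖x‖ ^ 3 else ‖x‖) := by
  obtain ⟨C, hC, h⟩ := taylor3 φ
  obtain ⟨D, hD, k⟩ := taylor1 φ l hl
  refine ⟨C + D, by positivity, fun x => ?_⟩
  have hx := norm_nonneg x
  unfold Rm
  split_ifs with hc
  · have := h x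
    rw [one_mul]
    refine this.trans ?_
    have : 0 ≤ ‖x‖ ^ 3 := by positivity
    nlinarith
  · have := k x (not_le.1 hc)
    rw [zero_mul, zero_mul, sub_zero]
    refine this.trans ?_
    nlinarith

lemma meas_ind (l : ℝ) : Measurable (fun x : E4 => if ‖x‖ ≤ l then (1 : ℝ) else 0) :=
  Measurable.ite (measurableSet_le measurable_norm measurable_const) measurable_const
    measurable_const

lemma meas_Rm (φ : SchwartzMap E4 ℝ) (l : ℝ) : Measurable (Rm φ l) := by
  unfold Rm
  have h1 : Measurable (fun x : E4 => φ x) := φ.continuous.measurable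
  have h2 : Measurable (fun x : E4 => fderiv ℝ φ 0 x) := (fderiv ℝ φ 0).continuous.measurable
  have h3 : Measurable (fun x : E4 => fderiv ℝ (fderiv ℝ φ) 0 x x) := by
    apply Continuous.measurable
    fun_prop
  exact ((h1.sub_const _).sub h2).sub (((meas_ind l).mul_const _).mul h3)

lemma int_domR (l C : ℝ) (hl : 0 < l) :
    Integrable (fun x : E4 => (‖x‖ ^ (-(11/2) : ℝ) + ‖x‖ ^ (-(13/2) : ℝ))
      * (C * (if ‖x‖ ≤ l then ‖x‖ ^ 3 else ‖x‖))) := by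
  have h1 := int_dom l (-(5/2)) (-(9/2)) hl (by norm_num) (by norm_num)
  have h2 := int_dom l (-(7/2)) (-(11/2)) hl (by norm_num) (by norm_num)
  refine ((h1.add h2).const_mul C).congr ?_
  filter_upwards [ae_ne0] with x hx
  have hr : 0 < ‖x‖ := norm_pos_iff.2 hx
  have e : ∀ p : ℝ, ‖x‖ ^ p * ‖x‖ ^ 3 = ‖x‖ ^ (p + 3) := by
    intro p
    rw [Real.rpow_add hr]
    norm_cast
  have e' : ∀ p : ℝ, ‖x‖ ^ p * ‖x‖ = ‖x‖ ^ (p + 1) := by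
    intro p
    rw [Real.rpow_add hr, Real.rpow_one]
  simp only [Pi.add_apply]
  split_ifs
  · have a := e (-(11/2)); have b := e (-(13/2))
    norm_num at a b
    rw [← a, ← b]; ring
  · have a := e' (-(11/2)); have b := e' (-(13/2))
    norm_num at a b
    rw [← a, ← b]; ring

lemma int_domF0 (ψ : SchwartzMap E4 ℝ) (K : ℝ) :
    Integrable (fun x : E4 => K * (‖x‖ ^ (-(3/2) : ℝ) + ‖x‖ ^ (-(5/2) : ℝ)) * |ψ x|) := by
  obtain ⟨A, hA, hA'⟩ := ψ.decay 0 0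
  obtain ⟨B, hB, hB'⟩ := ψ.decay 5 0
  have h1 := int_dom 1 (-(3/2)) (-(13/2)) one_pos (by norm_num) (by norm_num)
  have h2 := int_dom 1 (-(5/2)) (-(15/2)) one_pos (by norm_num) (by norm_num)
  refine ((h1.add h2).const_mul (|K| * (A + B))).mono' ?_ ?_
  · have : Measurable (fun x : E4 => ψ x) := ψ.continuous.measurable
    apply Measurable.aestronglyMeasurable
    fun_prop
  filter_upwards [ae_ne0] with x hx
  have hr : 0 < ‖x‖ := norm_pos_iff.2 hx
  have hA'' := hA' x
  have hB'' := hB' x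
  rw [norm_iteratedFDeriv_zero, Real.norm_eq_abs] at hA'' hB''
  rw [pow_zero, one_mul] at hA''
  have e : ∀ p : ℝ, ‖x‖ ^ p = ‖x‖ ^ (p - 5) * ‖x‖ ^ 5 := by
    intro p
    rw [Real.rpow_sub hr]
    norm_cast
    field_simp
  have p : ∀ p : ℝ, 0 < ‖x‖ ^ p := fun p => Real.rpow_pos_of_pos hr p
  have hψ := abs_nonneg (ψ x)
  rw [Real.norm_eq_abs, abs_mul, abs_mul, abs_abs, abs_of_pos (add_pos (p _) (p _)), mul_assoc, mul_assoc]
  refine mul_le_mul_of_nonneg_left ?_ (abs_nonneg K)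
  simp only [Pi.add_apply]
  split_ifs
  · have := p (-(3/2)); have := p (-(5/2))
    rw [mul_comm]
    refine mul_le_mul_of_nonneg_right (by linarith) (by positivity)
  · have a := e (-(3/2)); have b := e (-(5/2))
    norm_num at a b ⊢
    have p1 := p (-(13/2)); have p2 := p (-(15/2))
    rw [a, b, ← add_mul, mul_assoc, mul_comm]
    refine mul_le_mul_of_nonneg_right (by linarith) (by positivity)

lemma F0_zero (l r : ℝ) (hl : 0 < l) (hr : 0 < r) :
    F0 l (r ^ 2) = r ^ (-(2 : ℝ)) * Real.log (r / l) := by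
  rw [Real.rpow_neg hr.le, Real.log_div hr.ne' hl.ne']
  norm_cast
  simp only [F0, LL, Real.log_pow]
  field_simp
  push_cast
  ring

lemma F2_zero (l r : ℝ) (hr : 0 < r) :
    F2 l 0 (r ^ 2) = -16 * r ^ (-(6 : ℝ)) := by
  have h6 : r ^ (6 : ℝ) = r ^ 6 := by norm_cast
  rw [Real.rpow_neg hr.le, h6]
  simp only [F2]
  field_simp
  ring

lemma integrable_logpart (l : ℝ) (hl : 0 < l) (ψ : SchwartzMap E4 ℝ) :
    Integrable (fun x : E4 => ‖x‖ ^ (-(2 : ℝ)) * Real.log (‖x‖ / l) * ψ x) := by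
  refine (int_domF0 ψ (4+2*|Real.log l|)).mono' ?_ ?_
  · have : Measurable (fun x : E4 => ψ x) := ψ.continuous.measurable
    apply Measurable.aestronglyMeasurable
    fun_prop
  filter_upwards [ae_ne0] with x hx
  have hr : 0 < ‖x‖ := norm_pos_iff.2 hx
  rw [← F0_zero l _ hl hr, Real.norm_eq_abs, abs_mul]
  have := F0_bound l 0 ‖x‖ le_rfl hr
  rw [zero_add] at this
  exact mul_le_mul_of_nonneg_right this (abs_nonneg _)

lemma tendsto_log (l : ℝ) (hl : 0 < l) (ψ : SchwartzMap E4 ℝ) :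
    Filter.Tendsto (fun ε => ∫ x : E4, F0 l (ε + ‖x‖ ^ 2) * ψ x) (nhdsWithin 0 (Set.Ioi 0))
      (nhds (∫ x : E4, ‖x‖ ^ (-(2 : ℝ)) * Real.log (‖x‖ / l) * ψ x)) := by
  refine tendsto_integral_filter_of_dominated_convergence _ ?_ ?_
    (int_domF0 ψ (4+2*|Real.log l|)) ?_
  · refine Filter.Eventually.of_forall fun ε => ?_
    have : Measurable (fun x : E4 => ψ x) := ψ.continuous.measurable
    apply Measurable.aestronglyMeasurable
    unfold F0 LL
    fun_prop
  · filter_upwards [self_mem_nhdsWithin] with ε hε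
    filter_upwards [ae_ne0] with x hx
    have hr : 0 < ‖x‖ := norm_pos_iff.2 hx
    rw [Real.norm_eq_abs, abs_mul]
    exact mul_le_mul_of_nonneg_right (F0_bound l ε ‖x‖ (le_of_lt hε) hr) (abs_nonneg _)
  · filter_upwards [ae_ne0] with x hx
    have hr : 0 < ‖x‖ := norm_pos_iff.2 hx
    rw [← F0_zero l _ hl hr]
    refine Filter.Tendsto.mul_const _ ?_
    have hc : ContinuousAt (fun ε => F0 l (ε + ‖x‖ ^ 2)) 0 := by
      have hh : (0:ℝ) + ‖x‖^2 ≠ 0 := by positivity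
      unfold F0 LL
      refine ContinuousAt.div ?_ (by fun_prop) (by simpa using hx)
      refine ContinuousAt.sub (ContinuousAt.log (by fun_prop) hh) continuousAt_const
    have := hc.tendsto
    rw [zero_add] at this
    exact this.mono_left nhdsWithin_le_nhds

lemma F2R_bound (φ : SchwartzMap E4 ℝ) (l : ℝ) (hl : 0 < l) :
    ∃ g : E4 → ℝ, Integrable g ∧ ∀ ε, 0 ≤ ε → ∀ᵐ x : E4, ‖F2 l ε (ε + ‖x‖ ^ 2) * Rm φ l x‖ ≤ g x := by
  obtain ⟨C, hC, h⟩ := Rm_bound φ l hl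
  refine ⟨_, (int_domR l C hl).const_mul (688+288*(4+2*|Real.log l|)), fun ε hε => ?_⟩
  filter_upwards [ae_ne0] with x hx
  have hr : 0 < ‖x‖ := norm_pos_iff.2 hx
  rw [Real.norm_eq_abs, abs_mul, ← mul_assoc]
  exact mul_le_mul (F2_bound l ε ‖x‖ hε hr) (h x) (abs_nonneg _) (by positivity)

lemma meas_F2R (φ : SchwartzMap E4 ℝ) (l ε : ℝ) :
    AEStronglyMeasurable (fun x : E4 => F2 l ε (ε + ‖x‖ ^ 2) * Rm φ l x) volume := by
  have := meas_Rm φ l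
  apply Measurable.aestronglyMeasurable
  unfold F2 LL
  fun_prop

lemma integrable_F2R (φ : SchwartzMap E4 ℝ) (l ε : ℝ) (hl : 0 < l) (hε : 0 ≤ ε) :
    Integrable (fun x : E4 => F2 l ε (ε + ‖x‖ ^ 2) * Rm φ l x) := by
  obtain ⟨g, hg, h⟩ := F2R_bound φ l hl
  exact hg.mono' (meas_F2R φ l ε) (h ε hε)

lemma F2_zero_ae (φ : SchwartzMap E4 ℝ) (l : ℝ) :
    (fun x : E4 => F2 l 0 (0 + ‖x‖ ^ 2) * Rm φ l x) =ᵐ[volume]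
      (fun x : E4 => -16 * (‖x‖ ^ (-(6 : ℝ)) * Rm φ l x)) := by
  filter_upwards [ae_ne0] with x hx
  rw [zero_add, F2_zero l _ (norm_pos_iff.2 hx), mul_assoc]

lemma integrable_R (φ : SchwartzMap E4 ℝ) (l : ℝ) (hl : 0 < l) :
    Integrable (fun x : E4 => ‖x‖ ^ (-(6 : ℝ)) * Rm φ l x) := by
  have := ((integrable_F2R φ l 0 hl le_rfl).congr (F2_zero_ae φ l)).const_mul (-(1/16))
  refine this.congr (Filter.Eventually.of_forall fun x => ?_)
  simp only
  ring

lemma tendsto_F2R (φ : SchwartzMap E4 ℝ) (l : ℝ) (hl : 0 < l) :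
    Filter.Tendsto (fun ε => ∫ x : E4, F2 l ε (ε + ‖x‖ ^ 2) * Rm φ l x)
      (nhdsWithin 0 (Set.Ioi 0)) (nhds (-16 * ∫ x : E4, ‖x‖ ^ (-(6 : ℝ)) * Rm φ l x)) := by
  obtain ⟨g, hg, h⟩ := F2R_bound φ l hl
  rw [← integral_const_mul, ← integral_congr_ae (F2_zero_ae φ l)]
  refine tendsto_integral_filter_of_dominated_convergence g ?_ ?_ hg ?_
  · exact Filter.Eventually.of_forall fun ε => meas_F2R φ l ε
  · filter_upwards [self_mem_nhdsWithin] with ε hε using h ε (le_of_lt hε)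
  · filter_upwards [ae_ne0] with x hx
    have hr : 0 < ‖x‖ := norm_pos_iff.2 hx
    refine Filter.Tendsto.mul_const _ ?_
    have hc : ContinuousAt (fun ε => F2 l ε (ε + ‖x‖ ^ 2)) 0 := by
      have hh : (0:ℝ) + ‖x‖^2 ≠ 0 := by positivity
      unfold F2 LL
      have h1 : ContinuousAt (fun ε : ℝ => Real.log (ε + ‖x‖ ^ 2)) 0 :=
        ContinuousAt.log (by fun_prop) hh
      have hp : ∀ k : ℕ, ContinuousAt (fun ε : ℝ => (ε + ‖x‖ ^ 2) ^ k) 0 := by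
        intro k
        fun_prop
      have n1 : ContinuousAt (fun ε : ℝ =>
        ε * (272 - 96 * (Real.log (ε + ‖x‖ ^ 2) - 2 * Real.log l))) 0 := by fun_prop
      have n2 : ContinuousAt (fun ε : ℝ =>
        ε ^ 2 * (192 * (Real.log (ε + ‖x‖ ^ 2) - 2 * Real.log l) - 400)) 0 := by fun_prop
      exact ((continuousAt_const.div (hp 3) (pow_ne_zero _ hh)).add
        (n1.div (hp 4) (pow_ne_zero _ hh))).add (n2.div (hp 5) (pow_ne_zero _ hh))
    exact hc.tendsto.mono_left nhdsWithin_le_nhds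

lemma integrable_F2phi (φ : SchwartzMap E4 ℝ) (l ε : ℝ) (hε : 0 < ε) :
    Integrable (fun x : E4 => F2 l ε (ε + ‖x‖ ^ 2) * φ x) := by
  have hb : BddF ε (F2 l ε) := by
    have h := ((bdd_gen l ε (-16) 0 hε 2).add (bdd_gen l ε (ε*272) (-(ε*96)) hε 3)).add
      (bdd_gen l ε (ε^2*(-400)) (ε^2*192) hε 4)
    refine h.congr fun s => ?_
    simp only [F2]
    ring
  obtain ⟨C, hC⟩ := hb
  refine int_bdd (fun x : E4 => F2 l ε (ε + ‖x‖ ^ 2))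
    ((cont_F2 l ε hε).comp continuous_norm) C 0 (fun x => ?_) φ
  rw [pow_zero, mul_one]
  exact hC _ (by nlinarith [norm_nonneg x])

lemma integrable_F2quad (l ε : ℝ) (hε : 0 < ε) (i j : Fin 4) :
    Integrable (fun x : E4 =>
      (F2 l ε (ε + ‖x‖ ^ 2) * (if ‖x‖ ≤ l then (1:ℝ) else 0)) * (x i * x j)) := by
  have hc : Continuous (fun x : E4 => F2 l ε (ε + ‖x‖ ^ 2) * (x i * x j)) :=
    ((cont_F2 l ε hε).comp continuous_norm).mul (by fun_prop)
  have h := (hc.continuousOn (s := Metric.closedBall (0:E4) l)).integrableOn_compact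
    (isCompact_closedBall 0 l) (μ := volume)
  rw [← integrable_indicator_iff measurableSet_closedBall] at h
  refine h.congr (Filter.Eventually.of_forall fun x => ?_)
  by_cases hx : ‖x‖ ≤ l <;> simp [Set.indicator, hx]

lemma sum_quad_trace (φ : SchwartzMap E4 ℝ) (l ε : ℝ) (hl : 0 < l) (hε : 0 < ε) :
    Integrable (fun x : E4 => F2 l ε (ε + ‖x‖ ^ 2) *
      ((if ‖x‖ ≤ l then (1 : ℝ) else 0) * ((1 : ℝ) / 2) * fderiv ℝ (fderiv ℝ φ) 0 x x)) ∧
    ∫ x : E4, F2 l ε (ε + ‖x‖ ^ 2) *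
      ((if ‖x‖ ≤ l then (1 : ℝ) else 0) * ((1 : ℝ) / 2) * fderiv ℝ (fderiv ℝ φ) 0 x x)
      = π ^ 2 / 4 * lapl4 φ 0 * (∫ r in Set.Ioi (0:ℝ), r^5*(F2 l ε (ε+r^2) * (if r ≤ l then 1 else 0))) := by
  set A : Fin 4 → Fin 4 → ℝ := fun i j =>
    fderiv ℝ (fun y => fderiv ℝ φ y (EuclideanSpace.single j 1)) 0 (EuclideanSpace.single i 1)
    with hA
  have hq := quad_int (fun r => F2 l ε (ε + r ^ 2) * (if r ≤ l then (1:ℝ) else 0)) A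
    (integrable_F2quad l ε hε)
  have e : (fun x : E4 => F2 l ε (ε + ‖x‖ ^ 2) *
      ((if ‖x‖ ≤ l then (1 : ℝ) else 0) * ((1 : ℝ) / 2) * fderiv ℝ (fderiv ℝ φ) 0 x x))
      = fun x : E4 => (1/2) * ((F2 l ε (ε + ‖x‖ ^ 2) * (if ‖x‖ ≤ l then (1:ℝ) else 0)) *
        ∑ i, ∑ j, x i * x j * A i j) := by
    funext x
    rw [← sum_quad φ x]
    ring
  rw [e]
  constructor
  · refine Integrable.const_mul ?_ _
    simp only [Finset.mul_sum]
    refine integrable_finsetSum _ fun i _ => integrable_finsetSum _ fun j _ => ?_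
    refine ((integrable_F2quad l ε hε i j).mul_const (A i j)).congr
      (Filter.Eventually.of_forall fun x => ?_)
    simp only
    ring
  · rw [integral_const_mul, hq]
    have : ∑ i, A i i = lapl4 φ 0 := rfl
    rw [this]
    ring

lemma int_F2P (φ : SchwartzMap E4 ℝ) (l ε : ℝ) (hε : 0 < ε)
    (h : Integrable (fun x : E4 => F2 l ε (ε + ‖x‖ ^ 2) * (φ 0 + fderiv ℝ φ 0 x))) :
    ∫ x : E4, F2 l ε (ε + ‖x‖ ^ 2) * (φ 0 + fderiv ℝ φ 0 x) = 0 := by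
  have h1 := integral_neg_eq_self
    (fun x : E4 => F2 l ε (ε + ‖x‖ ^ 2) * (φ 0 + fderiv ℝ φ 0 x)) volume
  have h2 := integral_add h h.comp_neg
  rw [h1] at h2
  have h3 : ∫ x : E4, (F2 l ε (ε + ‖x‖ ^ 2) * (φ 0 + fderiv ℝ φ 0 x)
      + F2 l ε (ε + ‖-x‖ ^ 2) * (φ 0 + fderiv ℝ φ 0 (-x))) = 0 := by
    have : (fun x : E4 => F2 l ε (ε + ‖x‖ ^ 2) * (φ 0 + fderiv ℝ φ 0 x)
      + F2 l ε (ε + ‖-x‖ ^ 2) * (φ 0 + fderiv ℝ φ 0 (-x)))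
      = fun x : E4 => (2 * φ 0) * F2 l ε (ε + ‖x‖ ^ 2) := by
      funext x
      rw [norm_neg, map_neg]
      ring
    rw [this, integral_const_mul, int_F2 l ε hε, mul_zero]
  linarith

lemma split_eps (φ : SchwartzMap E4 ℝ) (l ε : ℝ) (hl : 0 < l) (hε : 0 < ε) :
    ∫ x : E4, F2 l ε (ε + ‖x‖ ^ 2) * φ x
      = (∫ x : E4, F2 l ε (ε + ‖x‖ ^ 2) * Rm φ l x)
        + π ^ 2 / 4 * lapl4 φ 0 *
          (∫ r in Set.Ioi (0:ℝ), r^5*(F2 l ε (ε+r^2) * (if r ≤ l then 1 else 0))) := by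
  obtain ⟨hQ, hQ'⟩ := sum_quad_trace φ l ε hl hε
  have hR := integrable_F2R φ l ε hl hε.le
  have hφ := integrable_F2phi φ l ε hε
  have hP : Integrable (fun x : E4 => F2 l ε (ε + ‖x‖ ^ 2) * (φ 0 + fderiv ℝ φ 0 x)) := by
    refine ((hφ.sub hR).sub hQ).congr (Filter.Eventually.of_forall fun x => ?_)
    simp only [Pi.sub_apply, Rm]
    ring
  have hP0 := int_F2P φ l ε hε hP
  have h1 := integral_add hR hQ
  have h2 := integral_add (hR.add hQ) hP
  simp only [Pi.add_apply] at h2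
  rw [h1, hP0, add_zero, hQ'] at h2
  rw [← h2]
  congr 1
  funext x
  simp only [Rm]
  ring

lemma main_eq (φ : SchwartzMap E4 ℝ) (l : ℝ) (hl : 0 < l) :
    ∫ x : E4, ‖x‖ ^ (-(2 : ℝ)) * Real.log (‖x‖ / l) * lapl4 (lapl4 φ) x
      = -16 * (∫ x : E4, ‖x‖ ^ (-(6 : ℝ)) * Rm φ l x) + π ^ 2 / 4 * lapl4 φ 0 * 20 := by
  obtain ⟨ψ₁, h₁⟩ := exists_lapl φ
  obtain ⟨ψ, h₂⟩ := exists_lapl ψ₁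
  have h : lapl4 (lapl4 φ) = ψ := by rw [h₁, h₂]
  have t1 := tendsto_log l hl ψ
  have t2 := (tendsto_F2R φ l hl).add
    ((H_tendsto l hl).const_mul (π ^ 2 / 4 * lapl4 φ 0))
  rw [h]
  refine tendsto_nhds_unique t1 (t2.congr' ?_)
  filter_upwards [self_mem_nhdsWithin] with ε hε
  rw [← h, biharm_ibp l ε hε φ, split_eps φ l ε hl hε, int_H l ε hl hε]

/-- renormalization of the sunset amplitude,
`R_4[r^{-6}] = -(1/16) Δ²(r^{-2} log(r/l)) + (5π²/16) Δδ`;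
both integrals are absolutely convergent. -/
theorem stmt_4 (l : ℝ) (hl : 0 < l) (φ : SchwartzMap (EuclideanSpace ℝ (Fin 4)) ℝ) :
    Integrable (fun x : EuclideanSpace ℝ (Fin 4) =>
        ‖x‖ ^ (-(6 : ℝ)) * (φ x - φ 0
          - ∑ i : Fin 4, x i * fderiv ℝ (⇑φ) 0 (EuclideanSpace.single i 1)
          - (if ‖x‖ ≤ l then (1 : ℝ) else 0) * ((1 : ℝ) / 2) *
              ∑ i : Fin 4, ∑ j : Fin 4, x i * x j *
                fderiv ℝ (fun y => fderiv ℝ (⇑φ) y (EuclideanSpace.single j 1)) 0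
                  (EuclideanSpace.single i 1))) ∧
    Integrable (fun x : EuclideanSpace ℝ (Fin 4) =>
        ‖x‖ ^ (-(2 : ℝ)) * Real.log (‖x‖ / l) * lapl4 (lapl4 (⇑φ)) x) ∧
    (∫ x : EuclideanSpace ℝ (Fin 4),
        ‖x‖ ^ (-(6 : ℝ)) * (φ x - φ 0
          - ∑ i : Fin 4, x i * fderiv ℝ (⇑φ) 0 (EuclideanSpace.single i 1)
          - (if ‖x‖ ≤ l then (1 : ℝ) else 0) * ((1 : ℝ) / 2) *
              ∑ i : Fin 4, ∑ j : Fin 4, x i * x j *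
                fderiv ℝ (fun y => fderiv ℝ (⇑φ) y (EuclideanSpace.single j 1)) 0
                  (EuclideanSpace.single i 1)))
      = -(1 / 16) * (∫ x : EuclideanSpace ℝ (Fin 4),
            ‖x‖ ^ (-(2 : ℝ)) * Real.log (‖x‖ / l) * lapl4 (lapl4 (⇑φ)) x)
        + (5 * Real.pi ^ 2 / 16) * lapl4 (⇑φ) 0 := by
  have e : ∀ x : EuclideanSpace ℝ (Fin 4), (φ x - φ 0
          - ∑ i : Fin 4, x i * fderiv ℝ (⇑φ) 0 (EuclideanSpace.single i 1)
          - (if ‖x‖ ≤ l then (1 : ℝ) else 0) * ((1 : ℝ) / 2) *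
              ∑ i : Fin 4, ∑ j : Fin 4, x i * x j *
                fderiv ℝ (fun y => fderiv ℝ (⇑φ) y (EuclideanSpace.single j 1)) 0
                  (EuclideanSpace.single i 1)) = Rm φ l x := by
    intro x
    rw [sum_lin, sum_quad]
    rfl
  simp only [e]
  refine ⟨integrable_R φ l hl, ?_, ?_⟩
  · obtain ⟨ψ₁, h₁⟩ := exists_lapl φ
    obtain ⟨ψ, h₂⟩ := exists_lapl ψ₁
    rw [h₁, h₂]
    exact integrable_logpart l hl ψ
  · have := main_eq φ l hl
    rw [this]
    ring

end
end

section
/- Let l > 0. For every Schwartz function φ on ℝ^4 one has ∫_{ℝ^4} |x|^{−4} ( φ(x) − θ(l−|x|) φ(0) ) dx = − ∫_{ℝ^4} |x|^{−4} log(|x|/l) (x·∇φ(x)) dx, where θ is the Heaviside step function; both integrals are absolutely convergent. (That is, the Epstein–Glaser subtraction extension of r^{−4} on ℝ^4 with the sharp infrared regulator θ(l−r) coincides with the differential-renormalization extension R_4[r^{−4}] = ∂_α(x^α r^{−4} log(r/l)).) -/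
open MeasureTheory Real SchwartzMap
noncomputable section

lemma dom4 (F : E4 → ℝ) (k : ℝ → ℝ) (hk : IntegrableOn k (Set.Ioi 0))
    (hF : AEStronglyMeasurable F volume) (hb : ∀ x, x ≠ 0 → ‖x‖ ^ 3 * |F x| ≤ k ‖x‖) :
    Integrable F := by
  have h1 : Integrable (fun x : E4 => (fun y : ℝ => (y ^ 3)⁻¹ * k y) ‖x‖) volume := by
    rw [integrable_fun_norm_addHaar (volume : Measure E4) (f := fun y : ℝ => (y ^ 3)⁻¹ * k y)]
    refine hk.congr_fun (fun y hy => ?_) measurableSet_Ioi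
    have hy : (0 : ℝ) < y := hy
    simp
    field_simp
  refine h1.mono' hF ?_
  have : ∀ᵐ x : E4, x ≠ 0 := by
    simp [ae_iff]
  filter_upwards [this] with x hx
  have hx' : 0 < ‖x‖ := norm_pos_iff.mpr hx
  have := hb x hx
  rw [Real.norm_eq_abs, inv_mul_eq_div, le_div_iff₀ (by positivity)]
  linarith

lemma polar4_s5 (F : E4 → ℝ) (hF : Integrable F) :
    ∫ x, F x = ∫ ω, (∫ r in Set.Ioi (0:ℝ), r ^ 3 * F (r • (ω : E4)))
      ∂((volume : Measure E4).toSphere) := by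
  have mp := (volume : Measure E4).measurePreserving_homeomorphUnitSphereProd
  have me := (homeomorphUnitSphereProd E4).measurableEmbedding
  let G : Metric.sphere (0 : E4) 1 × Set.Ioi (0:ℝ) → ℝ := fun p => F (p.2.1 • (p.1 : E4))
  have hG : ∀ x : ({0}ᶜ : Set E4), G (homeomorphUnitSphereProd E4 x) = F x := by
    intro x
    have hx : ‖(x : E4)‖ ≠ 0 := norm_ne_zero_iff.mpr x.2
    simp [G, smul_smul, hx]
  have hI : Integrable G ((volume : Measure E4).toSphere.prod (Measure.volumeIoiPow 3)) := by
    have h := mp.integrable_comp_emb me (g := G)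
    simp only [finrank_euclideanSpace_fin] at h
    rw [← h]
    have : IntegrableOn F ({0}ᶜ : Set E4) := hF.integrableOn
    rw [integrableOn_iff_comap_subtypeVal (by measurability)] at this
    convert this using 1
    funext x
    exact hG x
  calc ∫ x, F x = ∫ x : ({(0)}ᶜ : Set E4), F x ∂((volume : Measure E4).comap (↑)) := by
        rw [integral_subtype_comap (measurableSet_singleton _).compl F,
          restrict_compl_singleton]
    _ = ∫ p, G p ∂((volume : Measure E4).toSphere.prod (Measure.volumeIoiPow 3)) := by
        have h := mp.integral_comp me G
        simp only [finrank_euclideanSpace_fin] at h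
        rw [← h]
        simp only [hG]
    _ = ∫ ω, (∫ r, G (ω, r) ∂(Measure.volumeIoiPow 3)) ∂((volume : Measure E4).toSphere) :=
        integral_prod _ hI
    _ = _ := by
        congr 1
        funext ω
        simp only [Measure.volumeIoiPow, ENNReal.ofReal, G]
        rw [integral_withDensity_eq_integral_smul,
          integral_subtype_comap measurableSet_Ioi
            fun a => Real.toNNReal (a ^ 3) • F (a • (ω : E4)),
          setIntegral_congr_fun measurableSet_Ioi fun x hx => ?_]
        · rw [NNReal.smul_def, Real.coe_toNNReal _ (pow_nonneg (le_of_lt hx) _), smul_eq_mul]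
        · exact (measurable_subtype_coe.pow_const _).real_toNNReal

lemma ray (l : ℝ) (hl : 0 < l) (g g' : ℝ → ℝ) (C : ℝ)
    (hg : ∀ r, HasDerivAt g (g' r) r)
    (h0 : ∀ r, 0 < r → |g r - g 0| ≤ C * r)
    (hi : ∀ r, 0 < r → r ^ 2 * |g r| ≤ C)
    (hA : IntegrableOn (fun r => r⁻¹ * (g r - (if r ≤ l then (1:ℝ) else 0) * g 0)) (Set.Ioi 0))
    (hB : IntegrableOn (fun r => Real.log (r / l) * g' r) (Set.Ioi 0)) :
    ∫ r in Set.Ioi (0:ℝ), r⁻¹ * (g r - (if r ≤ l then (1:ℝ) else 0) * g 0)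
      = - ∫ r in Set.Ioi (0:ℝ), Real.log (r / l) * g' r := by
  rw [eq_neg_iff_add_eq_zero, ← integral_add hA hB]
  set S : ℝ → ℝ := fun r => r⁻¹ * (g r - (if r ≤ l then (1:ℝ) else 0) * g 0) +
    Real.log (r / l) * g' r with hS
  have hSi : IntegrableOn S (Set.Ioi 0) := hA.add hB
  have hlog : ∀ r, 0 < r → HasDerivAt (fun r => Real.log (r / l)) r⁻¹ r := by
    intro r hr
    have := ((hasDerivAt_id r).div_const l).log (by simp; constructor <;> positivity)
    have h2 : (1 / l / (id r / l) : ℝ) = r⁻¹ := by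
      simp only [id_eq]
      field_simp
    exact this.congr_deriv h2
  rw [← Set.Ioc_union_Ioi_eq_Ioi hl.le, setIntegral_union (by
    exact Set.Ioc_disjoint_Ioi le_rfl) measurableSet_Ioi
    (hSi.mono_set Set.Ioc_subset_Ioi_self) (hSi.mono_set (Set.Ioi_subset_Ioi hl.le))]
  have e1 : ∫ r in Set.Ioc 0 l, S r = 0 := by
    rw [← intervalIntegral.integral_of_le hl.le]
    have hd : ∀ r ∈ Set.Ioo 0 l,
        HasDerivAt (fun r => Real.log (r / l) * (g r - g 0)) (S r) r := by
      intro r hr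
      refine ((hlog r hr.1).fun_mul ((hg r).sub_const (g 0))).congr_deriv ?_
      simp [hS, hr.2.le]
    have t0 : Filter.Tendsto (fun r => Real.log (r / l) * (g r - g 0))
        (nhdsWithin 0 (Set.Ioi 0)) (nhds 0) := by
      have c : Continuous (fun r : ℝ => (C * l) * |(r / l) * Real.log (r / l)|) := by
        have := Real.continuous_mul_log.comp (continuous_id.div_const l)
        exact continuous_const.mul this.abs
      have c0 := (c.tendsto 0).mono_left (nhdsWithin_le_nhds (s := Set.Ioi 0))
      simp only [zero_div, zero_mul, abs_zero, mul_zero] at c0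
      refine squeeze_zero_norm' ?_ c0
      filter_upwards [self_mem_nhdsWithin] with r hr
      have hr : 0 < r := hr
      rw [Real.norm_eq_abs, abs_mul, abs_mul, abs_of_pos (div_pos hr hl)]
      calc |Real.log (r / l)| * |g r - g 0| ≤ |Real.log (r / l)| * (C * r) := by
            gcongr; exact h0 r hr
        _ = _ := by field_simp
    have tl : Filter.Tendsto (fun r => Real.log (r / l) * (g r - g 0))
        (nhdsWithin l (Set.Iio l)) (nhds 0) := by
      have : ContinuousAt (fun r => Real.log (r / l) * (g r - g 0)) l :=
        ((hlog l hl).continuousAt).mul ((hg l).continuousAt.sub continuousAt_const)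
      have := this.tendsto.mono_left (nhdsWithin_le_nhds (s := Set.Iio l))
      simpa [hl.ne'] using this
    have := intervalIntegral.integral_eq_sub_of_hasDerivAt_of_tendsto hl hd
      ((intervalIntegrable_iff_integrableOn_Ioc_of_le hl.le).2
        (hSi.mono_set Set.Ioc_subset_Ioi_self)) t0 tl
    simpa using this
  have e2 : ∫ r in Set.Ioi l, S r = 0 := by
    have hd : ∀ r ∈ Set.Ioi l, HasDerivAt (fun r => Real.log (r / l) * g r) (S r) r := by
      intro r hr
      have hr : l < r := hr
      refine ((hlog r (hl.trans hr)).fun_mul (hg r)).congr_deriv ?_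
      simp [hS, hr.not_ge]
    have ti : Filter.Tendsto (fun r => Real.log (r / l) * g r) Filter.atTop (nhds 0) := by
      have c0 : Filter.Tendsto (fun r : ℝ => (C / l) * r⁻¹) Filter.atTop (nhds 0) := by
        simpa using tendsto_inv_atTop_zero.const_mul (C / l)
      refine squeeze_zero_norm' ?_ c0
      filter_upwards [Filter.eventually_ge_atTop l] with r hr
      have hr0 : 0 < r := hl.trans_le hr
      have h1 : 1 ≤ r / l := (one_le_div hl).2 hr
      rw [Real.norm_eq_abs, abs_mul, abs_of_nonneg (Real.log_nonneg h1)]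
      have h2 : Real.log (r / l) ≤ r / l := (Real.log_le_sub_one_of_pos (by positivity)).trans
        (by linarith)
      have h3 : |g r| ≤ C / r ^ 2 := by
        rw [le_div_iff₀ (by positivity)]; linarith [hi r hr0]
      calc Real.log (r / l) * |g r| ≤ (r / l) * (C / r ^ 2) := by gcongr
        _ = _ := by field_simp
    have hc : ContinuousWithinAt (fun r => Real.log (r / l) * g r) (Set.Ici l) l :=
      (((hlog l hl).continuousAt).mul (hg l).continuousAt).continuousWithinAt
    have := integral_Ioi_of_hasDerivAt_of_tendsto hc hd
      (hSi.mono_set (Set.Ioi_subset_Ioi hl.le)) ti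
    simpa [hl.ne'] using this
  rw [e1, e2, add_zero]

def kk (l C : ℝ) (r : ℝ) : ℝ :=
  Set.indicator (Set.Ioc 0 l) (fun r => C * (1 + |Real.log (r / l)|)) r +
  Set.indicator (Set.Ioi l) (fun r => C * r ^ (-2 : ℝ)) r

lemma kk_int (l C : ℝ) (hl : 0 < l) : IntegrableOn (kk l C) (Set.Ioi 0) := by
  refine Integrable.integrableOn ?_
  refine Integrable.add ?_ ?_
  · rw [integrable_indicator_iff measurableSet_Ioc]
    have h : IntervalIntegrable (fun r => Real.log (r / l)) volume 0 l := by
      have := (intervalIntegral.intervalIntegrable_log' (a := 0) (b := 1)).comp_mul_right (c := l⁻¹)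
        (by simpa using hl.ne')
      simpa [div_eq_mul_inv] using this
    have h := ((intervalIntegrable_iff_integrableOn_Ioc_of_le hl.le).1 h).abs
    exact ((integrable_const (1:ℝ)).add h).const_mul C
  · rw [integrable_indicator_iff measurableSet_Ioi]
    exact (integrableOn_Ioi_rpow_of_lt (by norm_num) hl).const_mul C

/-- the Epstein–Glaser subtraction extension of `r^{-4}` on `ℝ^4` with
sharp infrared regulator `θ(l-r)` coincides with the differential-renormalization
extension `R_4[r^{-4}] = ∂_α(x^α r^{-4} log(r/l))`; both integrals are absolutely
convergent. -/
theorem stmt_5 (l : ℝ) (hl : 0 < l) (φ : SchwartzMap (EuclideanSpace ℝ (Fin 4)) ℝ) :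
    Integrable (fun x : EuclideanSpace ℝ (Fin 4) =>
        ‖x‖ ^ (-(4 : ℝ)) * (φ x - (if ‖x‖ ≤ l then (1 : ℝ) else 0) * φ 0)) ∧
    Integrable (fun x : EuclideanSpace ℝ (Fin 4) =>
        ‖x‖ ^ (-(4 : ℝ)) * Real.log (‖x‖ / l) * fderiv ℝ (⇑φ) x x) ∧
    (∫ x : EuclideanSpace ℝ (Fin 4),
        ‖x‖ ^ (-(4 : ℝ)) * (φ x - (if ‖x‖ ≤ l then (1 : ℝ) else 0) * φ 0))
      = -∫ x : EuclideanSpace ℝ (Fin 4),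
          ‖x‖ ^ (-(4 : ℝ)) * Real.log (‖x‖ / l) * fderiv ℝ (⇑φ) x x := by
  obtain ⟨C1, hC1, b1⟩ := φ.decay 1 0
  obtain ⟨C2, hC2, b2⟩ := φ.decay 2 0
  obtain ⟨C3, hC3, b3⟩ := φ.decay 0 1
  obtain ⟨C4, hC4, b4⟩ := φ.decay 3 1
  simp only [norm_iteratedFDeriv_zero, norm_iteratedFDeriv_one, pow_zero, one_mul, pow_one,
    Real.norm_eq_abs] at b1 b2 b3 b4
  set M := C1 + C2 + C3 + C4 / l with hM
  have hM4 : 0 < C4 / l := by positivity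
  have hM0 : 0 < M := by positivity
  have hdiff : Differentiable ℝ φ := φ.differentiable
  have hlip : ∀ x : E4, |φ x - φ 0| ≤ C3 * ‖x‖ := by
    intro x
    have := Convex.norm_image_sub_le_of_norm_fderiv_le (𝕜 := ℝ) (f := φ) (C := C3)
      (s := Set.univ) (fun y _ => hdiff y) (fun y _ => b3 y) convex_univ
      (Set.mem_univ (0 : E4)) (Set.mem_univ x)
    simpa using this
  have hrp : ∀ r : ℝ, 0 < r → r ^ 3 * r ^ (-(4 : ℝ)) = r⁻¹ := by
    intro r hr
    rw [show (-(4:ℝ)) = -((4:ℕ):ℝ) by norm_num, Real.rpow_neg hr.le, Real.rpow_natCast]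
    field_simp
  have hDm : Measurable (fun x : E4 => fderiv ℝ (⇑φ) x x) := by
    have : Continuous (fun x : E4 => fderiv ℝ (⇑φ) x x) :=
      ((φ.smooth 1).continuous_fderiv (by norm_num)).clm_apply continuous_id
    exact this.measurable
  have hφm : Measurable φ := φ.continuous.measurable
  have hm1 : Measurable (fun x : E4 =>
      ‖x‖ ^ (-(4 : ℝ)) * (φ x - (if ‖x‖ ≤ l then (1 : ℝ) else 0) * φ 0)) := by
    have : Measurable (fun x : E4 => if ‖x‖ ≤ l then (1 : ℝ) else 0) :=
      Measurable.ite (measurableSet_le measurable_norm measurable_const)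
        measurable_const measurable_const
    exact (measurable_norm.pow_const _).mul (hφm.sub (this.mul_const _))
  have hm2 : Measurable (fun x : E4 =>
      ‖x‖ ^ (-(4 : ℝ)) * Real.log (‖x‖ / l) * fderiv ℝ (⇑φ) x x) :=
    ((measurable_norm.pow_const _).mul (measurable_norm.div_const l).log).mul hDm
  have hb1 : ∀ x : E4, x ≠ 0 → ‖x‖ ^ 3 *
      |‖x‖ ^ (-(4 : ℝ)) * (φ x - (if ‖x‖ ≤ l then (1 : ℝ) else 0) * φ 0)| ≤ kk l M ‖x‖ := by
    intro x hx
    have hr : 0 < ‖x‖ := norm_pos_iff.mpr hx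
    have hp := hrp ‖x‖ hr
    rw [abs_mul, abs_of_pos (Real.rpow_pos_of_pos hr _), ← mul_assoc, hp]
    by_cases h : ‖x‖ ≤ l
    · simp only [kk, h, if_true, one_mul, Set.indicator, Set.mem_Ioc, Set.mem_Ioi, hr, and_self,
        not_lt.mpr h, if_false, add_zero]
      calc ‖x‖⁻¹ * |φ x - φ 0| ≤ ‖x‖⁻¹ * (C3 * ‖x‖) := by gcongr; exact hlip x
        _ = C3 := by field_simp
        _ ≤ M * 1 := by linarith
        _ ≤ _ := by gcongr; linarith [abs_nonneg (Real.log (‖x‖ / l))]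
    · simp only [kk, h, if_false, zero_mul, sub_zero, Set.indicator, Set.mem_Ioc, Set.mem_Ioi,
        and_false, not_le.mp h, if_true, zero_add]
      have h3 : |φ x| ≤ C1 / ‖x‖ := by
        rw [le_div_iff₀ hr]; linarith [b1 x]
      rw [Real.rpow_neg hr.le, Real.rpow_two]
      calc ‖x‖⁻¹ * |φ x| ≤ ‖x‖⁻¹ * (C1 / ‖x‖) := by gcongr
        _ = C1 * (‖x‖ ^ 2)⁻¹ := by field_simp
        _ ≤ _ := by gcongr; linarith
  have hb2 : ∀ x : E4, x ≠ 0 → ‖x‖ ^ 3 *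
      |‖x‖ ^ (-(4 : ℝ)) * Real.log (‖x‖ / l) * fderiv ℝ (⇑φ) x x| ≤ kk l M ‖x‖ := by
    intro x hx
    have hr : 0 < ‖x‖ := norm_pos_iff.mpr hx
    have hp := hrp ‖x‖ hr
    rw [abs_mul, abs_mul, abs_of_pos (Real.rpow_pos_of_pos hr _), ← mul_assoc, ← mul_assoc, hp]
    have hD : |fderiv ℝ (⇑φ) x x| ≤ ‖fderiv ℝ (⇑φ) x‖ * ‖x‖ := (fderiv ℝ (⇑φ) x).le_opNorm x
    have hD' : ‖x‖⁻¹ * |Real.log (‖x‖ / l)| * |fderiv ℝ (⇑φ) x x| ≤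
        |Real.log (‖x‖ / l)| * ‖fderiv ℝ (⇑φ) x‖ := by
      calc _ ≤ ‖x‖⁻¹ * |Real.log (‖x‖ / l)| * (‖fderiv ℝ (⇑φ) x‖ * ‖x‖) := by gcongr
        _ = _ := by field_simp
    refine hD'.trans ?_
    by_cases h : ‖x‖ ≤ l
    · simp only [kk, h, if_true, Set.indicator, Set.mem_Ioc, Set.mem_Ioi, hr, and_self,
        not_lt.mpr h, if_false, add_zero]
      calc |Real.log (‖x‖ / l)| * ‖fderiv ℝ (⇑φ) x‖ ≤ |Real.log (‖x‖ / l)| * M := by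
            gcongr; linarith [b3 x]
        _ ≤ _ := by linarith
    · simp only [kk, h, if_false, Set.indicator, Set.mem_Ioc, Set.mem_Ioi,
        and_false, not_le.mp h, if_true, zero_add]
      have h3 : ‖fderiv ℝ (⇑φ) x‖ ≤ C4 / ‖x‖ ^ 3 := by
        rw [le_div_iff₀ (by positivity)]; linarith [b4 x]
      have h1 : 1 ≤ ‖x‖ / l := (one_le_div hl).2 (not_le.mp h).le
      have h2 : |Real.log (‖x‖ / l)| ≤ ‖x‖ / l := by
        rw [abs_of_nonneg (Real.log_nonneg h1)]
        exact (Real.log_le_sub_one_of_pos (by positivity)).trans (by linarith)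
      rw [Real.rpow_neg hr.le, Real.rpow_two]
      calc |Real.log (‖x‖ / l)| * ‖fderiv ℝ (⇑φ) x‖ ≤ (‖x‖ / l) * (C4 / ‖x‖ ^ 3) := by gcongr
        _ = (C4 / l) * (‖x‖ ^ 2)⁻¹ := by field_simp
        _ ≤ _ := by gcongr; linarith
  have hk := kk_int l M hl
  have I1 := dom4 _ _ hk hm1.aestronglyMeasurable hb1
  have I2 := dom4 _ _ hk hm2.aestronglyMeasurable hb2
  refine ⟨I1, I2, ?_⟩
  rw [polar4_s5 _ I1, polar4_s5 _ I2, ← integral_neg]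
  congr 1
  funext ω
  have hω : ‖(ω : E4)‖ = 1 := by simp
  have hω0 : (ω : E4) ≠ 0 := by
    intro h; rw [h] at hω; simp at hω
  have hn : ∀ r : ℝ, 0 < r → ‖r • (ω : E4)‖ = r := by
    intro r hr; rw [norm_smul, hω, Real.norm_eq_abs, abs_of_pos hr, mul_one]
  have hsm : Measurable (fun r : ℝ => r • (ω : E4)) := by fun_prop
  -- one-dimensional integrability along a ray
  have ray_int : ∀ F : E4 → ℝ, Measurable F → (∀ x, x ≠ 0 → ‖x‖ ^ 3 * |F x| ≤ kk l M ‖x‖) →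
      IntegrableOn (fun r : ℝ => r ^ 3 * F (r • (ω : E4))) (Set.Ioi 0) := by
    intro F hF hb
    refine Integrable.mono' hk
      ((measurable_id.pow_const 3).mul (hF.comp hsm)).aestronglyMeasurable ?_
    filter_upwards [ae_restrict_mem measurableSet_Ioi] with r hr
    have hr : 0 < r := hr
    have := hb (r • (ω : E4)) (smul_ne_zero hr.ne' hω0)
    rw [hn r hr] at this
    rw [Real.norm_eq_abs, abs_mul, abs_of_pos (by positivity : 0 < r ^ 3)]
    exact this
  have J1 := ray_int _ hm1 hb1
  have J2 := ray_int _ hm2 hb2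
  have E1 : Set.EqOn (fun r : ℝ => r ^ 3 * (‖r • (ω : E4)‖ ^ (-(4 : ℝ)) * (φ (r • (ω : E4)) -
      (if ‖r • (ω : E4)‖ ≤ l then (1 : ℝ) else 0) * φ 0)))
      (fun r => r⁻¹ * (φ (r • (ω : E4)) - (if r ≤ l then (1 : ℝ) else 0) *
        φ ((0:ℝ) • (ω : E4)))) (Set.Ioi 0) := by
    intro r hr
    have hr : 0 < r := hr
    simp only [hn r hr, zero_smul]
    rw [← mul_assoc, hrp r hr]
  have E2 : Set.EqOn (fun r : ℝ => r ^ 3 * (‖r • (ω : E4)‖ ^ (-(4 : ℝ)) *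
      Real.log (‖r • (ω : E4)‖ / l) * fderiv ℝ (⇑φ) (r • (ω : E4)) (r • (ω : E4))))
      (fun r => Real.log (r / l) * fderiv ℝ (⇑φ) (r • (ω : E4)) (ω : E4)) (Set.Ioi 0) := by
    intro r hr
    have hr : 0 < r := hr
    simp only [hn r hr, map_smul, smul_eq_mul]
    rw [← mul_assoc, ← mul_assoc, ← mul_assoc, hrp r hr]
    field_simp
  rw [setIntegral_congr_fun measurableSet_Ioi E1, setIntegral_congr_fun measurableSet_Ioi E2]
  refine ray l hl (fun r => φ (r • (ω : E4))) (fun r => fderiv ℝ (⇑φ) (r • (ω : E4)) (ω : E4))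
    M ?_ ?_ ?_ (J1.congr_fun E1 measurableSet_Ioi) (J2.congr_fun E2 measurableSet_Ioi)
  · intro r
    have h := (hasDerivAt_id r).smul_const (ω : E4)
    rw [one_smul] at h
    exact (hdiff (r • (ω : E4))).hasFDerivAt.comp_hasDerivAt r h
  · intro r hr
    have := hlip (r • (ω : E4))
    rw [hn r hr] at this
    simp only [zero_smul]
    refine this.trans ?_
    gcongr
    linarith
  · intro r hr
    have := b2 (r • (ω : E4))
    rw [hn r hr] at this
    exact this.trans (by linarith)

end
end
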